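/- arXiv:1009.2131 — 3 statements merged into one kernel-verified Lean document; each statement's English description precedes it below -/
import Mathlib

section
/- Let X^(La)_n be the lazy random walk on ℤ with final time n and parameter r(n) ∈ (0,1). If n·r(n) → ∞ as n → ∞, then X^(La)_n/√(n r(n)) converges weakly to the standard normal distribution N(0,1). -/
open MeasureTheory Filter Real Topology

noncomputable section

/-- Distribution `p_m(x)` of the lazy random walk on ℤ with movement probability `ρ`:
`p_m(x) = (1−ρ)p_{m−1}(x) + (ρ/2)(p_{m−1}(x−1) + p_{m−1}(x+1))`, `p_0(x) = δ_0(x)`. -/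
def lazyDist (ρ : ℝ) : ℕ → ℤ → ℝ
  | 0 => fun x => if x = 0 then 1 else 0
  | m + 1 => fun x =>
      (1 - ρ) * lazyDist ρ m x + (ρ / 2) * (lazyDist ρ m (x - 1) + lazyDist ρ m (x + 1))

/-- Density of the normal distribution `N(0, v)`. -/
def normalPDF (v x : ℝ) : ℝ := (Real.sqrt (2 * π * v))⁻¹ * Real.exp (-(x ^ 2) / (2 * v))

lemma lazyDist_nonneg {ρ : ℝ} (hρ : ρ ∈ Set.Ioo (0 : ℝ) 1) (m : ℕ) (x : ℤ) :
    0 ≤ lazyDist ρ m x := by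
  induction m generalizing x with
  | zero => simp only [lazyDist]; split_ifs <;> norm_num
  | succ m ih =>
    simp only [lazyDist]
    have h1 : 0 ≤ 1 - ρ := by linarith [hρ.2]
    have h2 : 0 ≤ ρ / 2 := by linarith [hρ.1]
    exact add_nonneg (mul_nonneg h1 (ih x)) (mul_nonneg h2 (add_nonneg (ih _) (ih _)))

/-- Characteristic function of the lazy walk. -/
lemma lazyDist_hasSum_exp (ρ θ : ℝ) (m : ℕ) :
    HasSum (fun x : ℤ => (lazyDist ρ m x : ℂ) * Complex.exp (θ * x * Complex.I))
      ((1 + ((ρ * (Real.cos θ - 1) : ℝ) : ℂ)) ^ m) := by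
  induction m with
  | zero =>
    convert! hasSum_ite_eq (0 : ℤ) (1 : ℂ) using 2 with x
    · simp only [lazyDist]
      split_ifs with hx <;> simp [hx]
    
  | succ m ih =>
    have hm := ((Equiv.subRight (1 : ℤ)).hasSum_iff.2 ih).mul_left (Complex.exp (θ * Complex.I))
    have hp := ((Equiv.addRight (1 : ℤ)).hasSum_iff.2 ih).mul_left (Complex.exp (-θ * Complex.I))
    have := (ih.mul_left ((1 : ℂ) - ρ)).add ((hm.add hp).mul_left ((ρ : ℂ) / 2))
    convert! this using 2 with x
    · simp only [lazyDist, Function.comp, Equiv.subRight_apply, Equiv.coe_addRight]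
      have e1 : Complex.exp (θ * x * Complex.I) = Complex.exp (θ * Complex.I) *
          Complex.exp (θ * ((x - 1 : ℤ) : ℂ) * Complex.I) := by
        rw [← Complex.exp_add]; congr 1; push_cast; ring
      have e2 : Complex.exp (θ * x * Complex.I) = Complex.exp (-θ * Complex.I) *
          Complex.exp (θ * ((x + 1 : ℤ) : ℂ) * Complex.I) := by
        rw [← Complex.exp_add]; congr 1; push_cast; ring
      push_cast at e1 e2 ⊢
      linear_combination (ρ / 2 * lazyDist ρ m (x - 1) : ℂ) * e1 +
        (ρ / 2 * lazyDist ρ m (x + 1) : ℂ) * e2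
    · have hc : (Real.cos θ : ℂ) =
          (Complex.exp (θ * Complex.I) + Complex.exp (-θ * Complex.I)) / 2 := by
        rw [Complex.ofReal_cos, Complex.cos]
      rw [pow_succ]
      push_cast at hc ⊢
      rw [hc]
      ring

lemma lazyDist_hasSum (ρ : ℝ) (m : ℕ) : HasSum (lazyDist ρ m) 1 := by
  have := lazyDist_hasSum_exp ρ 0 m
  simp only [Real.cos_zero, sub_self, mul_zero, Complex.ofReal_zero, add_zero, one_pow,
    zero_mul, Complex.exp_zero, mul_one] at this
  rw [← Complex.ofReal_one] at this
  exact Complex.hasSum_ofReal.1 this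

/-- The law of the lazy walk as a probability mass function. -/
def lazyPMF (ρ : ℝ) (hρ : ρ ∈ Set.Ioo (0 : ℝ) 1) (m : ℕ) : PMF ℤ :=
  ⟨fun x => ENNReal.ofReal (lazyDist ρ m x), by
    have h := ENNReal.ofReal_tsum_of_nonneg (lazyDist_nonneg hρ m) (lazyDist_hasSum ρ m).summable
    rw [(lazyDist_hasSum ρ m).tsum_eq, ENNReal.ofReal_one] at h
    rw [h]
    exact ENNReal.summable.hasSum⟩

/-- The law of the rescaled lazy walk. -/
def lazyLaw (ρ : ℝ) (hρ : ρ ∈ Set.Ioo (0 : ℝ) 1) (m : ℕ) (s : ℝ) : ProbabilityMeasure ℝ :=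
  ⟨(lazyPMF ρ hρ m).toMeasure.map (fun x : ℤ => (x : ℝ) / s),
    Measure.isProbabilityMeasure_map (measurable_of_countable _).aemeasurable⟩

lemma lazyPMF_toReal (ρ : ℝ) (hρ : ρ ∈ Set.Ioo (0 : ℝ) 1) (m : ℕ) (x : ℤ) :
    (lazyPMF ρ hρ m x).toReal = lazyDist ρ m x :=
  ENNReal.toReal_ofReal (lazyDist_nonneg hρ m x)

lemma charFun_lazyLaw (ρ : ℝ) (hρ : ρ ∈ Set.Ioo (0 : ℝ) 1) (m : ℕ) (s t : ℝ) :
    charFun (lazyLaw ρ hρ m s : Measure ℝ) t =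
      (1 + ((ρ * (Real.cos (t / s) - 1) : ℝ) : ℂ)) ^ m := by
  rw [charFun_apply_real]
  change ∫ x, Complex.exp (t * x * Complex.I)
    ∂((lazyPMF ρ hρ m).toMeasure.map (fun x : ℤ => (x : ℝ) / s)) = _
  rw [integral_map (measurable_of_countable _).aemeasurable (by fun_prop)]
  rw [PMF.integral_eq_tsum]
  · rw [← (lazyDist_hasSum_exp ρ (t / s) m).tsum_eq]
    refine tsum_congr fun x => ?_
    rw [lazyPMF_toReal, Complex.real_smul]
    congr 2
    push_cast
    ring
  · refine Integrable.of_bound (measurable_of_countable _).aestronglyMeasurable 1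
      (ae_of_all _ fun x => ?_)
    rw [← Complex.ofReal_mul, Complex.norm_exp_ofReal_mul_I]

lemma lazyLaw_Iic (ρ : ℝ) (hρ : ρ ∈ Set.Ioo (0 : ℝ) 1) (m : ℕ) (s y : ℝ) :
    ((lazyLaw ρ hρ m s : Measure ℝ) (Set.Iic y)).toReal =
      ∑' x : ℤ, if (x : ℝ) / s ≤ y then lazyDist ρ m x else 0 := by
  change (((lazyPMF ρ hρ m).toMeasure.map (fun x : ℤ => (x : ℝ) / s)) (Set.Iic y)).toReal = _
  rw [Measure.map_apply (measurable_of_countable _) measurableSet_Iic,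
    PMF.toMeasure_apply_eq_tsum, ENNReal.tsum_toReal_eq]
  · refine tsum_congr fun x => ?_
    by_cases hx : (x : ℝ) / s ≤ y
    · rw [if_pos hx, Set.indicator_of_mem (by exact hx)]
      exact lazyPMF_toReal ρ hρ m x
    · rw [if_neg hx, Set.indicator_of_notMem (by exact hx)]
      simp
  · intro x
    exact ne_top_of_le_ne_top (PMF.apply_ne_top (lazyPMF ρ hρ m) x)
      (Set.indicator_le_self _ _ x)

lemma tendsto_sq_mul_cos (t : ℝ) :
    Tendsto (fun s : ℝ => s ^ 2 * (Real.cos (t / s) - 1)) atTop (𝓝 (-t ^ 2 / 2)) := by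
  have h0 : Tendsto (fun s : ℝ => t / 2 / s) atTop (𝓝 0) := tendsto_id.const_div_atTop _
  have h1 := (Real.continuous_sinc.tendsto 0).comp h0
  rw [Real.sinc_zero] at h1
  have h2 := (h1.pow 2).const_mul (-t ^ 2 / 2)
  rw [one_pow, mul_one] at h2
  refine h2.congr' ?_
  filter_upwards [eventually_gt_atTop 0] with s hs
  have hc : Real.cos (t / s) - 1 = -2 * Real.sin (t / 2 / s) ^ 2 := by
    have : t / s = 2 * (t / 2 / s) := by ring
    rw [this, Real.cos_two_mul, Real.cos_sq']
    ring
  rw [hc, Function.comp_apply]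
  by_cases ht : t = 0
  · simp [ht]
  · rw [Real.sinc_of_ne_zero (by positivity)]
    field_simp

/-- **Central limit theorem for the lazy random walk.** If `n·r(n) → ∞` as `n → ∞`,
then `X^(La)_n/√(n r(n))` converges weakly to `N(0,1)`. -/
theorem lazy_rw_clt
    (r : ℕ → ℝ) (hr : ∀ n, r n ∈ Set.Ioo (0 : ℝ) 1)
    (h : Tendsto (fun n : ℕ => (n : ℝ) * r n) atTop atTop) :
    ∀ y : ℝ, Tendsto
      (fun n : ℕ => ∑' x : ℤ,
        if (x : ℝ) / Real.sqrt ((n : ℝ) * r n) ≤ y then lazyDist (r n) n x else 0)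
      atTop (𝓝 (∫ u in Set.Iio y, normalPDF 1 u)) := by
  intro y
  let γ : ProbabilityMeasure ℝ := ⟨ProbabilityTheory.gaussianReal 0 1, inferInstance⟩
  have hconv : Tendsto (fun n : ℕ => lazyLaw (r n) (hr n) n (Real.sqrt ((n : ℝ) * r n)))
      atTop (𝓝 γ) := by
    refine ProbabilityMeasure.tendsto_of_tendsto_charFun fun t => ?_
    simp_rw [charFun_lazyLaw]
    have hγ : charFun (γ : Measure ℝ) t = Complex.exp ((-t ^ 2 / 2 : ℝ) : ℂ) := by
      change charFun (ProbabilityTheory.gaussianReal 0 1) t = _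
      rw [ProbabilityTheory.charFun_gaussianReal]
      congr 1
      push_cast
      ring
    rw [hγ]
    refine Complex.tendsto_one_add_pow_exp_of_tendsto ?_
    have h1 := (tendsto_sq_mul_cos t).comp (Real.tendsto_sqrt_atTop.comp h)
    have h2 := (Complex.continuous_ofReal.tendsto _).comp h1
    refine h2.congr fun n => ?_
    simp only [Function.comp_apply]
    rw [Real.sq_sqrt (mul_nonneg n.cast_nonneg (hr n).1.le)]
    push_cast
    ring
  have hfr : (γ : Measure ℝ) (frontier (Set.Iic y)) = 0 := by
    have := ProbabilityTheory.nullSingletonClass_gaussianReal (μ := 0) (v := 1) one_ne_zero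
    rw [frontier_Iic]
    exact measure_singleton (μ := ProbabilityTheory.gaussianReal 0 1) y
  have hlim := ProbabilityMeasure.tendsto_measure_of_null_frontier_of_tendsto' hconv hfr
  have hlim' := (ENNReal.tendsto_toReal (measure_ne_top (γ : Measure ℝ) (Set.Iic y))).comp hlim
  have hval : ((γ : Measure ℝ) (Set.Iic y)).toReal = ∫ u in Set.Iio y, normalPDF 1 u := by
    change (ProbabilityTheory.gaussianReal 0 1 (Set.Iic y)).toReal = _
    rw [ProbabilityTheory.gaussianReal_apply_eq_integral 0 one_ne_zero,
      ENNReal.toReal_ofReal (integral_nonneg (ProbabilityTheory.gaussianPDFReal_nonneg _ _)),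
      integral_Iic_eq_integral_Iio]
    simp [ProbabilityTheory.gaussianPDFReal, normalPDF]
  rw [hval] at hlim'
  exact hlim'.congr fun n => lazyLaw_Iic _ _ _ _ _
end
end

section
/- Let X^(F)_n be the position at time n of the FTD-DTQW with final time n, parameter r(n), and initial coin state φ_0 = q_L e_L + q_R e_R with |q_L|² + |q_R|² = 1. Assume n√r(n) → ∞ as n → ∞. Then X^(F)_n/(n√r(n)) converges weakly to the random variable A^{φ_0}(1) whose density is ρ(x; 1) = {1 − (q_L conj(q_R) + conj(q_L) q_R)·x}·1_{(−1,1)}(x)/(π√(1 − x²)). -/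
open MeasureTheory Filter Real Topology

noncomputable section

/-- Coin-state amplitude of the discrete-time quantum walk on ℤ with quantum coin `H`
and initial coin state `φ` (localized at the origin). -/
def dtqwAmp (H : Matrix (Fin 2) (Fin 2) ℂ) (φ : Fin 2 → ℂ) : ℕ → ℤ → Fin 2 → ℂ
  | 0 => fun x => if x = 0 then φ else 0
  | n + 1 => fun x i =>
      if i = 0 then
        H 0 0 * dtqwAmp H φ n (x + 1) 0 + H 0 1 * dtqwAmp H φ n (x + 1) 1
      else
        H 1 0 * dtqwAmp H φ n (x - 1) 0 + H 1 1 * dtqwAmp H φ n (x - 1) 1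

/-- Position distribution `P(X_n = x) = ‖Ψ_n(x)‖²` of the DTQW. -/
def dtqwDist (H : Matrix (Fin 2) (Fin 2) ℂ) (φ : Fin 2 → ℂ) (n : ℕ) (x : ℤ) : ℝ :=
  ‖dtqwAmp H φ n x 0‖ ^ 2 + ‖dtqwAmp H φ n x 1‖ ^ 2

/-- The final-time-dependent quantum coin. -/
def ftdCoin (ρ : ℝ) : Matrix (Fin 2) (Fin 2) ℂ :=
  !![(Real.sqrt ρ : ℂ), (Real.sqrt (1 - ρ) : ℂ);
     (Real.sqrt (1 - ρ) : ℂ), -(Real.sqrt ρ : ℂ)]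

/-- Density `ρ(x; r)` of `A^{φ_0}(r)`, with bias `c = q_L q̄_R + q̄_L q_R`. -/
def biasedArcsineDensity (c r x : ℝ) : ℝ :=
  if |x| < r then (1 - c * x / r) / (π * Real.sqrt (r ^ 2 - x ^ 2)) else 0

/-- Fourier transform of the walk (pair of components). -/
def wkF (a b p q : ℂ) (k : ℝ) : ℕ → ℂ × ℂ
  | 0 => (p, q)
  | n + 1 =>
      (Complex.exp (k * Complex.I) * (a * (wkF a b p q k n).1 + b * (wkF a b p q k n).2),
       Complex.exp (-(k * Complex.I)) * (b * (wkF a b p q k n).1 - a * (wkF a b p q k n).2))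

lemma wkF_hasSum (ρ : ℝ) (φ : Fin 2 → ℂ) (k : ℝ) (n : ℕ) :
    HasSum (fun x : ℤ => Complex.exp (-(k * x * Complex.I)) * dtqwAmp (ftdCoin ρ) φ n x 0)
      (wkF (√ρ : ℝ) (√(1 - ρ) : ℝ) (φ 0) (φ 1) k n).1 ∧
    HasSum (fun x : ℤ => Complex.exp (-(k * x * Complex.I)) * dtqwAmp (ftdCoin ρ) φ n x 1)
      (wkF (√ρ : ℝ) (√(1 - ρ) : ℝ) (φ 0) (φ 1) k n).2 := by
  induction n with
  | zero =>
    constructor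
    · convert hasSum_single (f := fun x : ℤ => Complex.exp (-(k * x * Complex.I)) *
        dtqwAmp (ftdCoin ρ) φ 0 x 0) 0 ?_ using 1
      · simp [wkF, dtqwAmp]
      · intro x hx; simp [dtqwAmp, hx]
    · convert hasSum_single (f := fun x : ℤ => Complex.exp (-(k * x * Complex.I)) *
        dtqwAmp (ftdCoin ρ) φ 0 x 1) 0 ?_ using 1
      · simp [wkF, dtqwAmp]
      · intro x hx; simp [dtqwAmp, hx]
  | succ n ih =>
    obtain ⟨h0, h1⟩ := ih
    constructor
    · have h := ((h0.mul_left ((√ρ : ℝ) : ℂ)).add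
        (h1.mul_left ((√(1 - ρ) : ℝ) : ℂ))).mul_left (Complex.exp (k * Complex.I))
      have h' := (Equiv.addRight (1 : ℤ)).hasSum_iff.mpr h
      refine h'.congr_fun ?_
      intro x
      have : Complex.exp (-(k * x * Complex.I)) = Complex.exp (k * Complex.I) *
          Complex.exp (-(k * ((x + 1 : ℤ) : ℂ) * Complex.I)) := by
        rw [← Complex.exp_add]; congr 1; push_cast; ring
      simp only [dtqwAmp, ftdCoin, Function.comp, Equiv.coe_addRight, this]
      simp
      ring
    · have h := ((h0.mul_left ((√(1 - ρ) : ℝ) : ℂ)).sub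
        (h1.mul_left ((√ρ : ℝ) : ℂ))).mul_left (Complex.exp (-(k * Complex.I)))
      have h' := (Equiv.subRight (1 : ℤ)).hasSum_iff.mpr h
      refine h'.congr_fun ?_
      intro x
      have : Complex.exp (-(k * x * Complex.I)) = Complex.exp (-(k * Complex.I)) *
          Complex.exp (-(k * ((x - 1 : ℤ) : ℂ) * Complex.I)) := by
        rw [← Complex.exp_add]; congr 1; push_cast; ring
      simp only [dtqwAmp, ftdCoin, Function.comp, Equiv.subRight_apply, this]
      simp
      ring

lemma dtqwAmp_support (H : Matrix (Fin 2) (Fin 2) ℂ) (φ : Fin 2 → ℂ) (n : ℕ) :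
    ∀ x : ℤ, x ∉ Finset.Icc (-(n : ℤ)) n → dtqwAmp H φ n x = 0 := by
  induction n with
  | zero => intro x hx; have : x ≠ 0 := by rintro rfl; simp at hx
            simp [dtqwAmp, this]
  | succ n ih =>
    intro x hx
    rw [Finset.mem_Icc] at hx
    push_cast at hx
    have h1 := ih (x + 1) (by rw [Finset.mem_Icc]; omega)
    have h2 := ih (x - 1) (by rw [Finset.mem_Icc]; omega)
    funext i
    simp [dtqwAmp, h1, h2]

lemma wkF_eq_sum (ρ : ℝ) (φ : Fin 2 → ℂ) (k : ℝ) (n : ℕ) :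
    (wkF (√ρ : ℝ) (√(1 - ρ) : ℝ) (φ 0) (φ 1) k n).1 = ∑ x ∈ Finset.Icc (-(n : ℤ)) n,
      Complex.exp (-(k * x * Complex.I)) * dtqwAmp (ftdCoin ρ) φ n x 0 ∧
    (wkF (√ρ : ℝ) (√(1 - ρ) : ℝ) (φ 0) (φ 1) k n).2 = ∑ x ∈ Finset.Icc (-(n : ℤ)) n,
      Complex.exp (-(k * x * Complex.I)) * dtqwAmp (ftdCoin ρ) φ n x 1 := by
  obtain ⟨h0, h1⟩ := wkF_hasSum ρ φ k n
  constructor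
  · refine h0.unique (hasSum_sum_of_ne_finset_zero fun x hx => ?_)
    simp [dtqwAmp_support _ φ n x hx]
  · refine h1.unique (hasSum_sum_of_ne_finset_zero fun x hx => ?_)
    simp [dtqwAmp_support _ φ n x hx]

lemma integral_exp_int (m : ℤ) :
    ∫ k in (-π)..π, Complex.exp (k * m * Complex.I) = if m = 0 then (2 * π : ℂ) else 0 := by
  split_ifs with h
  · subst h; simp; ring
  · have hc : ((m : ℂ) * Complex.I) ≠ 0 := by simp [h]
    have := integral_exp_mul_complex (a := -π) (b := π) hc
    have e : ∀ k : ℝ, (k : ℂ) * m * Complex.I = m * Complex.I * k := fun k => by ring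
    simp_rw [e]
    rw [this]
    have : Complex.exp (m * Complex.I * (π : ℝ)) = Complex.exp (m * Complex.I * ((-π : ℝ) : ℂ)) := by
      rw [Complex.exp_eq_exp_iff_exists_int]
      exact ⟨m, by push_cast; ring⟩
    rw [this]; simp

lemma parseval_shift (s : Finset ℤ) (f : ℤ → ℂ) (ε : ℝ) :
    ∫ k in (-π)..π, (starRingEnd ℂ) (∑ x ∈ s, Complex.exp (-((k + ε : ℝ) * x * Complex.I)) * f x) *
      (∑ x ∈ s, Complex.exp (-(k * x * Complex.I)) * f x) =
    2 * π * ∑ x ∈ s, Complex.exp (ε * x * Complex.I) * (‖f x‖ ^ 2 : ℝ) := by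
  have e : ∀ k : ℝ, (starRingEnd ℂ) (∑ x ∈ s, Complex.exp (-((k + ε : ℝ) * x * Complex.I)) * f x) *
      (∑ x ∈ s, Complex.exp (-(k * x * Complex.I)) * f x) =
      ∑ x ∈ s, ∑ y ∈ s, (Complex.exp (ε * x * Complex.I) * ((starRingEnd ℂ) (f x) * f y)) *
        Complex.exp (k * ((x - y : ℤ) : ℂ) * Complex.I) := by
    intro k
    rw [map_sum, Finset.sum_mul_sum]
    refine Finset.sum_congr rfl fun x _ => Finset.sum_congr rfl fun y _ => ?_
    rw [map_mul, ← Complex.exp_conj]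
    simp only [map_neg, map_mul, Complex.conj_ofReal, Complex.conj_I, map_intCast]
    have : Complex.exp (-(((k + ε : ℝ) : ℂ) * x * -Complex.I)) * Complex.exp (-(k * y * Complex.I)) =
      Complex.exp (ε * x * Complex.I) * Complex.exp (k * ((x - y : ℤ) : ℂ) * Complex.I) := by
      rw [← Complex.exp_add, ← Complex.exp_add]; congr 1; push_cast; ring
    linear_combination ((starRingEnd ℂ) (f x) * f y) * this
  simp_rw [e]
  rw [intervalIntegral.integral_finsetSum]
  · rw [Finset.mul_sum]
    refine Finset.sum_congr rfl fun x hx => ?_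
    rw [intervalIntegral.integral_finsetSum]
    · simp_rw [intervalIntegral.integral_const_mul, integral_exp_int]
      rw [Finset.sum_eq_single x]
      · simp [← Complex.normSq_eq_conj_mul_self, Complex.normSq_eq_norm_sq]; ring
      · intro y _ hy; simp [sub_eq_zero, hy.symm]
      · exact fun h => absurd hx h
    · intro y _; apply Continuous.intervalIntegrable; fun_prop
  · intro x _; apply Continuous.intervalIntegrable; fun_prop

lemma wkF_norm (a b : ℝ) (hab : a ^ 2 + b ^ 2 = 1) (p q : ℂ) (k : ℝ) (n : ℕ) :
    ‖(wkF a b p q k n).1‖ ^ 2 + ‖(wkF a b p q k n).2‖ ^ 2 = ‖p‖ ^ 2 + ‖q‖ ^ 2 := by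
  induction n with
  | zero => simp [wkF]
  | succ n ih =>
    rw [← ih]
    have h1 : ‖Complex.exp (k * Complex.I)‖ = 1 := Complex.norm_exp_ofReal_mul_I k
    have h2 : ‖Complex.exp (-(k * Complex.I))‖ = 1 := by
      have := Complex.norm_exp_ofReal_mul_I (-k)
      simpa using this
    simp only [wkF, norm_mul, h1, h2, one_mul, Complex.sq_norm, Complex.normSq_apply,
      Complex.add_re, Complex.sub_re, Complex.add_im, Complex.sub_im, Complex.re_ofReal_mul,
      Complex.im_ofReal_mul]
    generalize (wkF a b p q k n).1 = z
    generalize (wkF a b p q k n).2 = w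
    linear_combination (z.re ^ 2 + z.im ^ 2 + w.re ^ 2 + w.im ^ 2) * hab

/-- First component of the spectral projection of the initial state. -/
def wkA (a b p q t c e : ℂ) : ℂ := (p + (e * (a * p + b * q) - t * p) / c) / 2

/-- Second component of the spectral projection of the initial state. -/
def wkB (a b p q t c e' : ℂ) : ℂ := (q + (e' * (b * p - a * q) - t * q) / c) / 2

lemma wk_eig (a b p q t c e e' : ℂ) (hab : a ^ 2 + b ^ 2 = 1) (he : e * e' = 1)
    (ht : 2 * t = a * (e - e')) (hc : c ^ 2 - t ^ 2 = 1) (hc0 : c ≠ 0) :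
    e * (a * wkA a b p q t c e + b * wkB a b p q t c e') = (c + t) * wkA a b p q t c e ∧
    e' * (b * wkA a b p q t c e - a * wkB a b p q t c e') = (c + t) * wkB a b p q t c e' := by
  unfold wkA wkB
  constructor
  · field_simp
    linear_combination (-p) * hc + (p * e * e') * hab - e * (a * p + b * q) * ht + p * he
  · field_simp
    linear_combination (-q) * hc - e' * (b * p - a * q) * ht + q * he + q * e * e' * hab

lemma wkF_closed (a b p q t c : ℂ) (k : ℝ) (hab : a ^ 2 + b ^ 2 = 1)
    (ht : 2 * t = a * (Complex.exp (k * Complex.I) - Complex.exp (-(k * Complex.I))))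
    (hc : c ^ 2 - t ^ 2 = 1) (hc0 : c ≠ 0) (n : ℕ) :
    (wkF a b p q k n).1 = (c + t) ^ n * wkA a b p q t c (Complex.exp (k * Complex.I)) +
      (-c + t) ^ n * wkA a b p q t (-c) (Complex.exp (k * Complex.I)) ∧
    (wkF a b p q k n).2 = (c + t) ^ n * wkB a b p q t c (Complex.exp (-(k * Complex.I))) +
      (-c + t) ^ n * wkB a b p q t (-c) (Complex.exp (-(k * Complex.I))) := by
  have he : Complex.exp (k * Complex.I) * Complex.exp (-(k * Complex.I)) = 1 := by
    rw [← Complex.exp_add]; simp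
  induction n with
  | zero =>
    simp only [wkF, wkA, wkB]
    constructor <;> field_simp <;> ring
  | succ n ih =>
    obtain ⟨h1, h2⟩ := wk_eig a b p q t c _ _ hab he ht hc hc0
    obtain ⟨h3, h4⟩ := wk_eig a b p q t (-c) _ _ hab he ht (by linear_combination hc)
      (neg_ne_zero.mpr hc0)
    obtain ⟨i1, i2⟩ := ih
    simp only [wkF]
    rw [i1, i2]
    constructor
    · linear_combination (c + t) ^ n * h1 + (-c + t) ^ n * h3
    · linear_combination (c + t) ^ n * h2 + (-c + t) ^ n * h4

lemma phase_tendsto (a : ℕ → ℝ) (ha : Tendsto a atTop (𝓝 0))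
    (hna : Tendsto (fun n : ℕ => (n : ℝ) * a n) atTop atTop) (ξ k : ℝ) :
    Tendsto (fun n : ℕ => (n : ℝ) * (arcsin (a n * Real.sin (k + ξ / (n * a n))) -
      arcsin (a n * Real.sin k))) atTop (𝓝 (ξ * Real.cos k)) := by
  have hs : Tendsto (fun n : ℕ => (n * a n : ℝ) • (Real.sin (k + (n * a n : ℝ)⁻¹ • ξ) - Real.sin k))
      atTop (𝓝 (ξ * Real.cos k)) := by
    have := (Real.hasDerivAt_sin k).hasFDerivAt.lim ξ
      (tendsto_norm_atTop_atTop.comp hna)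
    simpa using this
  have hx : Tendsto (fun n : ℕ => a n * Real.sin (k + ξ / (n * a n))) atTop (𝓝 0) := by
    refine ha.zero_mul_isBoundedUnder_le ?_
    exact isBoundedUnder_of ⟨1, fun n => Real.abs_sin_le_one _⟩
  have hy : Tendsto (fun n : ℕ => a n * Real.sin k) atTop (𝓝 0) := by
    simpa using ha.mul_const (Real.sin k)
  have hstr := (Real.hasStrictDerivAt_arcsin (x := 0) (by norm_num) (by norm_num)).hasStrictFDerivAt.isLittleO
  have h1 := hstr.comp_tendsto (show Tendsto (fun n : ℕ => (a n * Real.sin (k + ξ / (n * a n)),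
    a n * Real.sin k)) atTop (𝓝 ((0 : ℝ), (0 : ℝ))) from hx.prodMk_nhds hy)
  have h2 := (Asymptotics.isBigO_refl (fun n : ℕ => (n : ℝ)) atTop).mul_isLittleO h1
  have hs' : Tendsto (fun n : ℕ => (n : ℝ) * (a n * Real.sin (k + ξ / (n * a n)) - a n * Real.sin k))
      atTop (𝓝 (ξ * Real.cos k)) := by
    refine hs.congr fun n => ?_
    simp only [smul_eq_mul]
    rw [div_eq_inv_mul]; ring
  have h3 := h2.trans_isBigO (hs'.isBigO_one ℝ)
  rw [Asymptotics.isLittleO_one_iff] at h3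
  have h4 := h3.add hs'
  rw [zero_add] at h4
  refine h4.congr fun n => ?_
  simp
  ring

lemma tendsto_of_eq {f : ℕ → ℂ} {l l' : ℂ} (h : Tendsto f atTop (𝓝 l)) (e : l = l') :
    Tendsto f atTop (𝓝 l') := e ▸ h

lemma bdd_mul_zero {f g : ℕ → ℂ} (hg : ∀ n, ‖g n‖ ≤ 1) (h : Tendsto f atTop (𝓝 0)) :
    Tendsto (fun n => g n * f n) atTop (𝓝 0) := by
  refine squeeze_zero_norm (fun n => ?_) (tendsto_zero_iff_norm_tendsto_zero.mp h)
  rw [norm_mul]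
  exact mul_le_of_le_one_left (norm_nonneg _) (hg n)

lemma wkA_tendsto {a b t c e : ℕ → ℂ} {c0 e0 : ℂ} (p q : ℂ) (ha : Tendsto a atTop (𝓝 0))
    (hb : Tendsto b atTop (𝓝 1)) (ht : Tendsto t atTop (𝓝 0)) (hc : Tendsto c atTop (𝓝 c0))
    (hc0 : c0 ≠ 0) (he : Tendsto e atTop (𝓝 e0)) :
    Tendsto (fun n => wkA (a n) (b n) p q (t n) (c n) (e n)) atTop (𝓝 ((p + e0 * q / c0) / 2)) := by
  unfold wkA
  have := (((he.mul ((ha.mul_const p).add (hb.mul_const q))).sub (ht.mul_const p)).div hc hc0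
    |>.const_add p).div_const 2
  simpa using this

lemma wkB_tendsto {a b t c e : ℕ → ℂ} {c0 e0 : ℂ} (p q : ℂ) (ha : Tendsto a atTop (𝓝 0))
    (hb : Tendsto b atTop (𝓝 1)) (ht : Tendsto t atTop (𝓝 0)) (hc : Tendsto c atTop (𝓝 c0))
    (hc0 : c0 ≠ 0) (he : Tendsto e atTop (𝓝 e0)) :
    Tendsto (fun n => wkB (a n) (b n) p q (t n) (c n) (e n)) atTop (𝓝 ((q + e0 * p / c0) / 2)) := by
  unfold wkB
  have := (((he.mul ((hb.mul_const p).sub (ha.mul_const q))).sub (ht.mul_const q)).div hc hc0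
    |>.const_add q).div_const 2
  simpa using this

/-- the phase angle -/
def wkT (a k : ℝ) : ℝ := arcsin (a * Real.sin k)

lemma wkF_closed' (a b : ℝ) (p q : ℂ) (k : ℝ) (hab : a ^ 2 + b ^ 2 = 1) (ha0 : 0 ≤ a) (ha1 : a < 1)
    (n : ℕ) :
    (wkF a b p q k n).1 = Complex.exp ((n * wkT a k : ℝ) * Complex.I) *
        wkA a b p q ((a * Real.sin k : ℝ) * Complex.I) (Real.cos (wkT a k)) (Complex.exp (k * Complex.I)) +
      (-1) ^ n * Complex.exp (-((n * wkT a k : ℝ) * Complex.I)) *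
        wkA a b p q ((a * Real.sin k : ℝ) * Complex.I) (-Real.cos (wkT a k)) (Complex.exp (k * Complex.I)) ∧
    (wkF a b p q k n).2 = Complex.exp ((n * wkT a k : ℝ) * Complex.I) *
        wkB a b p q ((a * Real.sin k : ℝ) * Complex.I) (Real.cos (wkT a k)) (Complex.exp (-(k * Complex.I))) +
      (-1) ^ n * Complex.exp (-((n * wkT a k : ℝ) * Complex.I)) *
        wkB a b p q ((a * Real.sin k : ℝ) * Complex.I) (-Real.cos (wkT a k)) (Complex.exp (-(k * Complex.I))) := by
  have hlt : |a * Real.sin k| < 1 := by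
    rw [abs_mul, abs_of_nonneg ha0]
    nlinarith [Real.abs_sin_le_one k, abs_nonneg (Real.sin k)]
  rw [abs_lt] at hlt
  have hsin : Real.sin (wkT a k) = a * Real.sin k := Real.sin_arcsin hlt.1.le hlt.2.le
  have hcos : 0 < Real.cos (wkT a k) := by
    rw [wkT, Real.cos_arcsin]; apply Real.sqrt_pos.mpr; nlinarith
  have hz : (Real.cos (wkT a k) : ℂ) + (a * Real.sin k : ℝ) * Complex.I
      = Complex.exp (wkT a k * Complex.I) := by
    rw [← hsin, Complex.exp_mul_I]; simp
  have hw : -(Real.cos (wkT a k) : ℂ) + (a * Real.sin k : ℝ) * Complex.I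
      = -Complex.exp (-(wkT a k * Complex.I)) := by
    rw [← hsin, ← neg_mul, Complex.exp_mul_I]; simp; ring
  have key := wkF_closed a b p q ((a * Real.sin k : ℝ) * Complex.I) (Real.cos (wkT a k)) k
    (by exact_mod_cast hab) ?_ ?_ ?_ n
  · rw [hz, hw, neg_pow, ← Complex.exp_nat_mul, ← Complex.exp_nat_mul] at key
    have e1 : (n : ℂ) * (wkT a k * Complex.I) = (n * wkT a k : ℝ) * Complex.I := by push_cast; ring
    have e2 : (n : ℂ) * -(wkT a k * Complex.I) = -((n * wkT a k : ℝ) * Complex.I) := by push_cast; ring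
    rw [e1, e2] at key
    exact key
  · rw [← neg_mul, Complex.exp_mul_I, Complex.exp_mul_I]; push_cast
    rw [Complex.cos_neg, Complex.sin_neg]; ring
  · rw [← hsin]
    have : (Real.cos (wkT a k) : ℂ) ^ 2 + (Real.sin (wkT a k) : ℂ) ^ 2 = 1 := by
      exact_mod_cast Real.cos_sq_add_sin_sq _
    linear_combination this - (Real.sin (wkT a k) : ℂ) ^ 2 * Complex.I_sq
  · exact_mod_cast hcos.ne'

lemma inner_alg (z w z' w' A B C D A' B' C' D' s : ℂ) (hs : s * s = 1) (hss : (starRingEnd ℂ) s = s) :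
    (starRingEnd ℂ) (z' * A' + s * w' * C') * (z * A + s * w * C) +
    (starRingEnd ℂ) (z' * B' + s * w' * D') * (z * B + s * w * D) =
    ((starRingEnd ℂ) z' * z) * ((starRingEnd ℂ) A' * A + (starRingEnd ℂ) B' * B) +
    ((starRingEnd ℂ) w' * w) * ((starRingEnd ℂ) C' * C + (starRingEnd ℂ) D' * D) +
    ((s * (starRingEnd ℂ) z' * w) * ((starRingEnd ℂ) A' * C + (starRingEnd ℂ) B' * D) +
    (s * (starRingEnd ℂ) w' * z) * ((starRingEnd ℂ) C' * A + (starRingEnd ℂ) D' * B)) := by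
  simp only [map_add, map_mul, hss]
  linear_combination ((starRingEnd ℂ) w' * w) * ((starRingEnd ℂ) C' * C + (starRingEnd ℂ) D' * D) * hs

/-- The integrand in the characteristic function. -/
def wkG (a b p q : ℂ) (ε k : ℝ) (n : ℕ) : ℂ :=
  (starRingEnd ℂ) (wkF a b p q (k + ε) n).1 * (wkF a b p q k n).1 +
  (starRingEnd ℂ) (wkF a b p q (k + ε) n).2 * (wkF a b p q k n).2

lemma wkG_tendsto (a b : ℕ → ℝ) (ha0 : ∀ n, 0 ≤ a n) (ha1 : ∀ n, a n < 1)
    (hab : ∀ n, a n ^ 2 + b n ^ 2 = 1) (ha : Tendsto a atTop (𝓝 0)) (hb : Tendsto b atTop (𝓝 1))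
    (hna : Tendsto (fun n : ℕ => (n : ℝ) * a n) atTop atTop) (ξ k : ℝ) (p q : ℂ)
    (hpq : ‖p‖ ^ 2 + ‖q‖ ^ 2 = 1) :
    Tendsto (fun n => wkG (a n) (b n) p q (ξ / (n * a n)) k n) atTop
      (𝓝 (Complex.exp (-((ξ * Real.cos k : ℝ) * Complex.I)) *
        ((1 + ((starRingEnd ℂ) p * q * Complex.exp (k * Complex.I) +
          (starRingEnd ℂ) q * p * Complex.exp (-(k * Complex.I)))) / 2) +
        Complex.exp ((ξ * Real.cos k : ℝ) * Complex.I) *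
        ((1 - ((starRingEnd ℂ) p * q * Complex.exp (k * Complex.I) +
          (starRingEnd ℂ) q * p * Complex.exp (-(k * Complex.I)))) / 2))) := by
  have hε : Tendsto (fun n : ℕ => ξ / (n * a n)) atTop (𝓝 0) := hna.const_div_atTop ξ
  have hk' : Tendsto (fun n : ℕ => k + ξ / (n * a n)) atTop (𝓝 k) := by
    simpa using hε.const_add k
  have hkc : Tendsto (fun _ : ℕ => k) atTop (𝓝 k) := tendsto_const_nhds
  have haC : Tendsto (fun n => (a n : ℂ)) atTop (𝓝 0) := by
    exact_mod_cast (Complex.continuous_ofReal.tendsto 0).comp ha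
  have hbC : Tendsto (fun n => (b n : ℂ)) atTop (𝓝 1) := by
    exact_mod_cast (Complex.continuous_ofReal.tendsto 1).comp hb
  have hS : ∀ K : ℕ → ℝ, Tendsto K atTop (𝓝 k) →
      Tendsto (fun n => a n * Real.sin (K n)) atTop (𝓝 0) := fun K hK => by
    simpa using ha.mul ((Real.continuous_sin.tendsto k).comp hK)
  have hT : ∀ K : ℕ → ℝ, Tendsto K atTop (𝓝 k) →
      Tendsto (fun n => ((a n * Real.sin (K n) : ℝ) : ℂ) * Complex.I) atTop (𝓝 0) := fun K hK => by
    have := ((Complex.continuous_ofReal.tendsto 0).comp (hS K hK)).mul_const Complex.I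
    simpa using this
  have hC : ∀ K : ℕ → ℝ, Tendsto K atTop (𝓝 k) →
      Tendsto (fun n => ((Real.cos (wkT (a n) (K n)) : ℝ) : ℂ)) atTop (𝓝 1) := fun K hK => by
    have hcont : Continuous fun x : ℝ => ((Real.cos (arcsin x) : ℝ) : ℂ) := by
      have := Real.continuous_arcsin
      fun_prop
    have := (hcont.tendsto 0).comp (hS K hK)
    simpa [wkT, Function.comp_def] using this
  have hE : ∀ K : ℕ → ℝ, Tendsto K atTop (𝓝 k) →
      Tendsto (fun n => Complex.exp (K n * Complex.I)) atTop (𝓝 (Complex.exp (k * Complex.I))) :=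
    fun K hK => ((by fun_prop : Continuous fun x : ℝ => Complex.exp (x * Complex.I)).tendsto k).comp hK
  have hE' : ∀ K : ℕ → ℝ, Tendsto K atTop (𝓝 k) →
      Tendsto (fun n => Complex.exp (-(K n * Complex.I))) atTop (𝓝 (Complex.exp (-(k * Complex.I)))) :=
    fun K hK =>
      ((by fun_prop : Continuous fun x : ℝ => Complex.exp (-(x * Complex.I))).tendsto k).comp hK
  have h1 : (1 : ℂ) ≠ 0 := one_ne_zero
  have h2 : (-1 : ℂ) ≠ 0 := by norm_num
  have hA := fun K hK => wkA_tendsto p q haC hbC (hT K hK) (hC K hK) h1 (hE K hK)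
  have hB := fun K hK => wkB_tendsto p q haC hbC (hT K hK) (hC K hK) h1 (hE' K hK)
  have hA' := fun K hK => wkA_tendsto p q haC hbC (hT K hK) (hC K hK).neg h2 (hE K hK)
  have hB' := fun K hK => wkB_tendsto p q haC hbC (hT K hK) (hC K hK).neg h2 (hE' K hK)
  have cj : ∀ {f : ℕ → ℂ} {l : ℂ}, Tendsto f atTop (𝓝 l) →
      Tendsto (fun n => (starRingEnd ℂ) (f n)) atTop (𝓝 ((starRingEnd ℂ) l)) :=
    fun h => (Complex.continuous_conj.tendsto _).comp h
  have hph := phase_tendsto a ha hna ξ k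
  have hz : Tendsto (fun n : ℕ =>
      (starRingEnd ℂ) (Complex.exp ((n * wkT (a n) (k + ξ / (n * a n)) : ℝ) * Complex.I)) *
      Complex.exp ((n * wkT (a n) k : ℝ) * Complex.I)) atTop
      (𝓝 (Complex.exp (-((ξ * Real.cos k : ℝ) * Complex.I)))) := by
    refine (((by fun_prop : Continuous fun x : ℝ => Complex.exp (-(x * Complex.I))).tendsto _).comp
      hph).congr fun n => ?_
    simp only [Function.comp]
    rw [← Complex.exp_conj, ← Complex.exp_add]
    congr 1
    simp only [map_mul, Complex.conj_ofReal, Complex.conj_I, wkT]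
    push_cast; ring
  have hw : Tendsto (fun n : ℕ =>
      (starRingEnd ℂ) (Complex.exp (-((n * wkT (a n) (k + ξ / (n * a n)) : ℝ) * Complex.I))) *
      Complex.exp (-((n * wkT (a n) k : ℝ) * Complex.I))) atTop
      (𝓝 (Complex.exp ((ξ * Real.cos k : ℝ) * Complex.I))) := by
    refine (((by fun_prop : Continuous fun x : ℝ => Complex.exp (x * Complex.I)).tendsto _).comp
      hph).congr fun n => ?_
    simp only [Function.comp]
    rw [← Complex.exp_conj, ← Complex.exp_add]
    congr 1
    simp only [map_neg, map_mul, Complex.conj_ofReal, Complex.conj_I, wkT]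
    push_cast; ring
  have nrm : ∀ x : ℝ, ‖Complex.exp (x * Complex.I)‖ = 1 := Complex.norm_exp_ofReal_mul_I
  have nrm' : ∀ x : ℝ, ‖Complex.exp (-(x * Complex.I))‖ = 1 := fun x => by
    simpa using nrm (-x)
  have hee : Complex.exp (k * Complex.I) * Complex.exp (-(k * Complex.I)) = 1 := by
    rw [← Complex.exp_add]; simp
  have hce : (starRingEnd ℂ) (Complex.exp (k * Complex.I)) = Complex.exp (-(k * Complex.I)) := by
    rw [← Complex.exp_conj]; simp
  have hce' : (starRingEnd ℂ) (Complex.exp (-(k * Complex.I))) = Complex.exp (k * Complex.I) := by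
    rw [← Complex.exp_conj]; simp
  have hpq' : (starRingEnd ℂ) p * p + (starRingEnd ℂ) q * q = 1 := by
    rw [← Complex.normSq_eq_conj_mul_self, ← Complex.normSq_eq_conj_mul_self,
      Complex.normSq_eq_norm_sq, Complex.normSq_eq_norm_sq]
    exact_mod_cast hpq
  have L1 := hz.mul (((cj (hA _ hk')).mul (hA _ hkc)).add ((cj (hB _ hk')).mul (hB _ hkc)))
  have L2 := hw.mul (((cj (hA' _ hk')).mul (hA' _ hkc)).add ((cj (hB' _ hk')).mul (hB' _ hkc)))
  have L3 := ((cj (hA _ hk')).mul (hA' _ hkc)).add ((cj (hB _ hk')).mul (hB' _ hkc))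
  have L4 := ((cj (hA' _ hk')).mul (hA _ hkc)).add ((cj (hB' _ hk')).mul (hB _ hkc))
  have Z3 := tendsto_of_eq (l' := 0) L3 (by
    simp only [map_div₀, map_add, map_mul, hce, hce', map_one, map_neg, map_ofNat]
    linear_combination (-((starRingEnd ℂ) p * p + (starRingEnd ℂ) q * q) / 4) * hee)
  have Z4 := tendsto_of_eq (l' := 0) L4 (by
    simp only [map_div₀, map_add, map_mul, hce, hce', map_one, map_neg, map_ofNat]
    linear_combination (-((starRingEnd ℂ) p * p + (starRingEnd ℂ) q * q) / 4) * hee)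
  have nrs : ∀ n : ℕ, ‖(-1 : ℂ) ^ n‖ = 1 := fun n => by simp
  have L3' := bdd_mul_zero (g := fun n : ℕ => (-1 : ℂ) ^ n *
      (starRingEnd ℂ) (Complex.exp ((n * wkT (a n) (k + ξ / (n * a n)) : ℝ) * Complex.I)) *
      Complex.exp (-((n * wkT (a n) k : ℝ) * Complex.I)))
    (fun n => by rw [norm_mul, norm_mul, RCLike.norm_conj, nrm, nrm', nrs]; norm_num) Z3
  have L4' := bdd_mul_zero (g := fun n : ℕ => (-1 : ℂ) ^ n *
      (starRingEnd ℂ) (Complex.exp (-((n * wkT (a n) (k + ξ / (n * a n)) : ℝ) * Complex.I))) *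
      Complex.exp ((n * wkT (a n) k : ℝ) * Complex.I))
    (fun n => by rw [norm_mul, norm_mul, RCLike.norm_conj, nrm, nrm', nrs]; norm_num) Z4
  refine tendsto_of_eq (((L1.add L2).add (L3'.add L4')).congr fun n => ?_) ?_
  · unfold wkG
    obtain ⟨u1, u2⟩ := wkF_closed' (a n) (b n) p q k (hab n) (ha0 n) (ha1 n) n
    obtain ⟨v1, v2⟩ := wkF_closed' (a n) (b n) p q (k + ξ / (n * a n)) (hab n) (ha0 n) (ha1 n) n
    rw [u1, u2, v1, v2]
    rw [inner_alg]
    · rw [← mul_pow]; simp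
    · simp
  · simp only [map_div₀, map_add, map_mul, hce, hce', map_one, map_neg, map_ofNat]
    linear_combination ((Complex.exp (-((ξ * Real.cos k : ℝ) * Complex.I)) +
      Complex.exp ((ξ * Real.cos k : ℝ) * Complex.I)) *
      (((starRingEnd ℂ) p * p + (starRingEnd ℂ) q * q) / 4)) * hee +
      ((Complex.exp (-((ξ * Real.cos k : ℝ) * Complex.I)) +
      Complex.exp ((ξ * Real.cos k : ℝ) * Complex.I)) / 2) * hpq'

lemma wkF_cont (a b p q : ℂ) (n : ℕ) :
    (Continuous fun k : ℝ => (wkF a b p q k n).1) ∧ (Continuous fun k : ℝ => (wkF a b p q k n).2) := by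
  induction n with
  | zero => simp only [wkF]; exact ⟨continuous_const, continuous_const⟩
  | succ n ih =>
    obtain ⟨h1, h2⟩ := ih
    simp only [wkF]
    constructor <;> fun_prop

lemma wkG_cont (a b p q : ℂ) (ε : ℝ) (n : ℕ) : Continuous fun k : ℝ => wkG a b p q ε k n := by
  unfold wkG
  obtain ⟨h1, h2⟩ := wkF_cont a b p q n
  have h3 : Continuous fun k : ℝ => k + ε := by fun_prop
  exact ((Complex.continuous_conj.comp (h1.comp h3)).mul h1).add
    ((Complex.continuous_conj.comp (h2.comp h3)).mul h2)

lemma wkG_norm (a b : ℝ) (hab : a ^ 2 + b ^ 2 = 1) (p q : ℂ) (hpq : ‖p‖ ^ 2 + ‖q‖ ^ 2 = 1)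
    (ε k : ℝ) (n : ℕ) : ‖wkG a b p q ε k n‖ ≤ 1 := by
  have h1 := wkF_norm a b hab p q k n
  have h2 := wkF_norm a b hab p q (k + ε) n
  unfold wkG
  refine (norm_add_le _ _).trans ?_
  rw [norm_mul, norm_mul, RCLike.norm_conj, RCLike.norm_conj]
  nlinarith [sq_nonneg (‖(wkF a b p q (k + ε) n).1‖ - ‖(wkF a b p q k n).1‖),
    sq_nonneg (‖(wkF a b p q (k + ε) n).2‖ - ‖(wkF a b p q k n).2‖)]

lemma wkG_zero (a b : ℝ) (hab : a ^ 2 + b ^ 2 = 1) (p q : ℂ) (hpq : ‖p‖ ^ 2 + ‖q‖ ^ 2 = 1)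
    (k : ℝ) (n : ℕ) : wkG a b p q 0 k n = 1 := by
  have h1 := wkF_norm a b hab p q k n
  unfold wkG
  rw [add_zero, ← Complex.normSq_eq_conj_mul_self, ← Complex.normSq_eq_conj_mul_self,
      Complex.normSq_eq_norm_sq, Complex.normSq_eq_norm_sq]
  rw [hpq] at h1
  exact_mod_cast h1

lemma dist_fourier (ρ : ℝ) (φ : Fin 2 → ℂ) (ε : ℝ) (n : ℕ) :
    ∫ k in (-π)..π, wkG (√ρ : ℝ) (√(1 - ρ) : ℝ) (φ 0) (φ 1) ε k n =
    2 * π * ∑ x ∈ Finset.Icc (-(n : ℤ)) n,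
      Complex.exp (ε * x * Complex.I) * (dtqwDist (ftdCoin ρ) φ n x : ℝ) := by
  have h1 := parseval_shift (Finset.Icc (-(n : ℤ)) n) (fun x => dtqwAmp (ftdCoin ρ) φ n x 0) ε
  have h2 := parseval_shift (Finset.Icc (-(n : ℤ)) n) (fun x => dtqwAmp (ftdCoin ρ) φ n x 1) ε
  unfold wkG
  simp only [← (wkF_eq_sum ρ φ _ n).1, ← (wkF_eq_sum ρ φ _ n).2] at h1 h2
  obtain ⟨c1, c2⟩ := wkF_cont (√ρ : ℝ) (√(1 - ρ) : ℝ) (φ 0) (φ 1) n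
  have h3 : Continuous fun k : ℝ => k + ε := by fun_prop
  rw [intervalIntegral.integral_add, h1, h2, ← mul_add, ← Finset.sum_add_distrib]
  · congr 1
    refine Finset.sum_congr rfl fun x _ => ?_
    simp only [dtqwDist]
    push_cast; ring
  · exact ((Complex.continuous_conj.comp (c1.comp h3)).mul c1).intervalIntegrable _ _
  · exact ((Complex.continuous_conj.comp (c2.comp h3)).mul c2).intervalIntegrable _ _

lemma dist_sum (ρ : ℝ) (h0 : 0 < ρ) (h1 : ρ < 1) (φ : Fin 2 → ℂ) (hφ : ‖φ 0‖ ^ 2 + ‖φ 1‖ ^ 2 = 1)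
    (n : ℕ) : ∑ x ∈ Finset.Icc (-(n : ℤ)) n, dtqwDist (ftdCoin ρ) φ n x = 1 := by
  have h := dist_fourier ρ φ 0 n
  have hab : (√ρ) ^ 2 + (√(1 - ρ)) ^ 2 = 1 := by
    rw [Real.sq_sqrt h0.le, Real.sq_sqrt (by linarith)]; ring
  simp only [wkG_zero _ _ hab _ _ hφ] at h
  simp at h
  have hpi : (π : ℂ) ≠ 0 := by exact_mod_cast Real.pi_ne_zero
  have h' : (2 * π : ℂ) * 1 = 2 * π * ((∑ x ∈ Finset.Icc (-(n : ℤ)) n, dtqwDist (ftdCoin ρ) φ n x : ℝ) : ℂ) := by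
    push_cast
    rw [← h]; ring
  have := mul_left_cancel₀ (by simp) h'
  exact_mod_cast this.symm

lemma limit_integral (p q : ℂ) (ξ : ℝ) :
    ∫ k in (-π)..π, (Complex.exp (-((ξ * Real.cos k : ℝ) * Complex.I)) *
        ((1 + ((starRingEnd ℂ) p * q * Complex.exp (k * Complex.I) +
          (starRingEnd ℂ) q * p * Complex.exp (-(k * Complex.I)))) / 2) +
        Complex.exp ((ξ * Real.cos k : ℝ) * Complex.I) *
        ((1 - ((starRingEnd ℂ) p * q * Complex.exp (k * Complex.I) +
          (starRingEnd ℂ) q * p * Complex.exp (-(k * Complex.I)))) / 2)) =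
    2 * ∫ k in (0)..π, ((1 - (p * (starRingEnd ℂ) q + (starRingEnd ℂ) p * q).re * Real.cos k : ℝ) : ℂ) *
      Complex.exp (ξ * (Real.cos k : ℝ) * Complex.I) := by
  set G : ℝ → ℂ := fun k => (Complex.exp (-((ξ * Real.cos k : ℝ) * Complex.I)) *
        ((1 + ((starRingEnd ℂ) p * q * Complex.exp (k * Complex.I) +
          (starRingEnd ℂ) q * p * Complex.exp (-(k * Complex.I)))) / 2) +
        Complex.exp ((ξ * Real.cos k : ℝ) * Complex.I) *
        ((1 - ((starRingEnd ℂ) p * q * Complex.exp (k * Complex.I) +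
          (starRingEnd ℂ) q * p * Complex.exp (-(k * Complex.I)))) / 2)) with hG
  have hGc : Continuous G := by rw [hG]; fun_prop
  set c := (p * (starRingEnd ℂ) q + (starRingEnd ℂ) p * q).re with hcdef
  have hc : (starRingEnd ℂ) p * q + (starRingEnd ℂ) q * p = (c : ℂ) := by
    apply Complex.ext
    · simp [hcdef]; ring
    · simp; ring
  set h : ℝ → ℂ := fun k => ((1 - c * Real.cos k : ℝ) : ℂ) *
      Complex.exp (ξ * (Real.cos k : ℝ) * Complex.I) with hh
  have hhc : Continuous h := by rw [hh]; fun_prop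
  have hi := fun a b => hGc.intervalIntegrable (μ := volume) a b
  have e1 : ∫ k in (-π)..π, G k = (∫ k in (-π)..0, G k) + ∫ k in (0)..π, G k :=
    (intervalIntegral.integral_add_adjacent_intervals (hi _ _) (hi _ _)).symm
  have e2 : ∫ k in (-π)..0, G k = ∫ k in (0)..π, G (-k) := by
    rw [intervalIntegral.integral_comp_neg]; simp
  have e3 : ∫ k in (0)..π, h (π - k) = ∫ k in (0)..π, h k := by
    rw [intervalIntegral.integral_comp_sub_left]; simp
  have e4 : ∀ k, G (-k) + G k = h (π - k) + h k := by
    intro k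
    have hcos : Complex.exp (k * Complex.I) + Complex.exp (-(k * Complex.I)) = 2 * (Real.cos k : ℝ) := by
      rw [← neg_mul, Complex.exp_mul_I, Complex.exp_mul_I, Complex.cos_neg, Complex.sin_neg]
      push_cast; ring
    have x1 : Complex.exp (((-k : ℝ) : ℂ) * Complex.I) = Complex.exp (-(k * Complex.I)) := by
      congr 1; push_cast; ring
    have x2 : Complex.exp (-(((-k : ℝ) : ℂ) * Complex.I)) = Complex.exp (k * Complex.I) := by
      congr 1; push_cast; ring
    have x3 : Complex.exp (ξ * ((-Real.cos k : ℝ) : ℂ) * Complex.I) =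
        Complex.exp (-((ξ * Real.cos k : ℝ) * Complex.I)) := by congr 1; push_cast; ring
    have x4 : Complex.exp (ξ * ((Real.cos k : ℝ) : ℂ) * Complex.I) =
        Complex.exp ((ξ * Real.cos k : ℝ) * Complex.I) := by congr 1; push_cast; ring
    simp only [hG, hh, Real.cos_neg, Real.cos_pi_sub, x1, x2, x3, x4]
    generalize Complex.exp (-((ξ * Real.cos k : ℝ) * Complex.I)) = u at *
    generalize Complex.exp ((ξ * Real.cos k : ℝ) * Complex.I) = v at *
    push_cast
    push_cast at hcos
    rw [← hc]
    linear_combination ((u - v) / 2 * ((starRingEnd ℂ) p * q + (starRingEnd ℂ) q * p)) * hcos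
  rw [e1, e2, ← intervalIntegral.integral_add]
  · simp_rw [e4]
    rw [intervalIntegral.integral_add, e3]
    · ring
    · exact (hhc.comp (by fun_prop : Continuous fun k : ℝ => π - k)).intervalIntegrable _ _
    · exact hhc.intervalIntegrable _ _
  · exact (hGc.comp continuous_neg).intervalIntegrable _ _
  · exact hi _ _

lemma wk_char_tendsto (r : ℕ → ℝ) (hr0 : ∀ n, 0 < r n) (hr1 : ∀ n, r n < 1)
    (hrlim : Tendsto r atTop (𝓝 0))
    (hinf : Tendsto (fun n : ℕ => (n : ℝ) * Real.sqrt (r n)) atTop atTop)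
    (φ : Fin 2 → ℂ) (hφ : ‖φ 0‖ ^ 2 + ‖φ 1‖ ^ 2 = 1) (ξ : ℝ) :
    Tendsto (fun n : ℕ => ∑ x ∈ Finset.Icc (-(n : ℤ)) n,
      Complex.exp ((ξ / (n * √(r n)) : ℝ) * x * Complex.I) * (dtqwDist (ftdCoin (r n)) φ n x : ℝ))
      atTop (𝓝 ((1 / π : ℂ) * ∫ k in (0)..π,
        ((1 - (φ 0 * (starRingEnd ℂ) (φ 1) + (starRingEnd ℂ) (φ 0) * φ 1).re * Real.cos k : ℝ) : ℂ) *
      Complex.exp (ξ * (Real.cos k : ℝ) * Complex.I))) := by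
  have hab : ∀ n, (√(r n)) ^ 2 + (√(1 - r n)) ^ 2 = 1 := fun n => by
    rw [Real.sq_sqrt (hr0 n).le, Real.sq_sqrt (by linarith [hr1 n])]; ring
  have ha : Tendsto (fun n => √(r n)) atTop (𝓝 0) := by
    simpa using hrlim.sqrt
  have hb : Tendsto (fun n => √(1 - r n)) atTop (𝓝 1) := by
    simpa using (hrlim.const_sub 1).sqrt
  have ha1 : ∀ n, √(r n) < 1 := fun n => by
    rw [Real.sqrt_lt' one_pos]; simpa using hr1 n
  have hlim : Tendsto (fun n : ℕ => ∫ k in (-π)..π,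
      wkG (√(r n) : ℝ) (√(1 - r n) : ℝ) (φ 0) (φ 1) (ξ / (n * √(r n))) k n) atTop
      (𝓝 (2 * ∫ k in (0)..π,
        ((1 - (φ 0 * (starRingEnd ℂ) (φ 1) + (starRingEnd ℂ) (φ 0) * φ 1).re * Real.cos k : ℝ) : ℂ) *
      Complex.exp (ξ * (Real.cos k : ℝ) * Complex.I))) := by
    rw [← limit_integral]
    apply intervalIntegral.tendsto_integral_filter_of_dominated_convergence (fun _ => (1 : ℝ))
    · exact .of_forall fun n => (wkG_cont _ _ _ _ _ _).aestronglyMeasurable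
    · exact .of_forall fun n => .of_forall fun k _ => wkG_norm _ _ (hab n) _ _ hφ _ _ _
    · simp
    · exact .of_forall fun k _ => wkG_tendsto _ _ (fun n => Real.sqrt_nonneg _) ha1 hab ha hb hinf ξ k
        _ _ hφ
  have hpi : (π : ℂ) ≠ 0 := by exact_mod_cast Real.pi_ne_zero
  refine tendsto_of_eq ((hlim.const_mul (1 / (2 * π) : ℂ)).congr fun n => ?_) ?_
  · rw [dist_fourier, ← mul_assoc, one_div_mul_cancel (by simp), one_mul]
  · rw [← mul_assoc]; congr 1; field_simp

lemma cos_image : Set.image Real.cos (Set.Ioo 0 π) = Set.Ioo (-1) 1 := by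
  ext u
  constructor
  · rintro ⟨k, hk, rfl⟩
    have hs := Real.sin_pos_of_mem_Ioo hk
    have := Real.sin_sq_add_cos_sq k
    constructor <;> nlinarith
  · intro hu
    refine ⟨Real.arccos u, ⟨Real.arccos_pos.mpr hu.2, ?_⟩, Real.cos_arccos hu.1.le hu.2.le⟩
    refine lt_of_le_of_ne (Real.arccos_le_pi u) fun h => ?_
    rw [Real.arccos_eq_pi] at h
    exact absurd hu.1 (not_lt.mpr h)

lemma dens_zero (c u : ℝ) (hu : u ∉ Set.Ioo (-1 : ℝ) 1) : biasedArcsineDensity c 1 u = 0 := by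
  have : ¬ |u| < 1 := fun h => hu (abs_lt.mp h)
  simp [biasedArcsineDensity, this]

lemma dens_cos (c k : ℝ) (hk : k ∈ Set.Ioo 0 π) :
    |(-Real.sin k)| * biasedArcsineDensity c 1 (Real.cos k) = (1 - c * Real.cos k) / π := by
  have hs := Real.sin_pos_of_mem_Ioo hk
  have h1 : |Real.cos k| < 1 := by
    have hm := Set.mem_image_of_mem Real.cos hk
    rw [cos_image] at hm
    exact abs_lt.mpr hm
  have h2 : √(1 ^ 2 - Real.cos k ^ 2) = Real.sin k := by
    rw [one_pow, ← Real.sin_sq, Real.sqrt_sq hs.le]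
  rw [biasedArcsineDensity, if_pos h1, h2, abs_neg, abs_of_pos hs]
  field_simp

lemma cos_deriv_within : ∀ x ∈ Set.Ioo 0 π, HasDerivWithinAt Real.cos (-Real.sin x) (Set.Ioo 0 π) x :=
  fun x _ => (Real.hasDerivAt_cos x).hasDerivWithinAt

lemma cos_inj_Ioo : Set.InjOn Real.cos (Set.Ioo 0 π) := Real.injOn_cos.mono Set.Ioo_subset_Icc_self

lemma dens_integral (c : ℝ) (g : ℝ → ℂ) :
    ∫ u, (biasedArcsineDensity c 1 u : ℂ) * g u =
      (1 / π : ℂ) * ∫ k in (0)..π, ((1 - c * Real.cos k : ℝ) : ℂ) * g (Real.cos k) := by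
  rw [← setIntegral_eq_integral_of_forall_compl_eq_zero (s := Set.Ioo (-1) 1)
    (fun u hu => by simp [dens_zero c u hu]), ← cos_image,
    integral_image_eq_integral_abs_deriv_smul measurableSet_Ioo cos_deriv_within cos_inj_Ioo,
    intervalIntegral.integral_of_le Real.pi_pos.le, integral_Ioc_eq_integral_Ioo,
    ← integral_const_mul]
  refine setIntegral_congr_fun measurableSet_Ioo fun k hk => ?_
  simp only [Complex.real_smul]
  rw [← mul_assoc, ← Complex.ofReal_mul, dens_cos c k hk]
  push_cast; ring

lemma dens_integrable (c : ℝ) : Integrable (biasedArcsineDensity c 1) := by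
  have h : IntegrableOn (biasedArcsineDensity c 1) (Set.Ioo (-1) 1) := by
    rw [← cos_image,
      integrableOn_image_iff_integrableOn_abs_deriv_smul measurableSet_Ioo cos_deriv_within cos_inj_Ioo]
    have : IntegrableOn (fun k => (1 - c * Real.cos k) / π) (Set.Ioo 0 π) :=
      (Continuous.integrableOn_Icc (by fun_prop)).mono_set Set.Ioo_subset_Icc_self
    refine this.congr_fun (fun k hk => ?_) measurableSet_Ioo
    simp only [smul_eq_mul]
    rw [dens_cos c k hk]
  exact (integrableOn_iff_integrable_of_support_subset (fun u hu => by
    by_contra h'; exact hu (dens_zero c u h'))).mp h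

lemma dens_meas (c : ℝ) : Measurable (biasedArcsineDensity c 1) := by
  unfold biasedArcsineDensity
  refine Measurable.ite (measurableSet_lt (by fun_prop) measurable_const) (by fun_prop) (by fun_prop)

lemma dens_nonneg (c : ℝ) (hc : |c| ≤ 1) (u : ℝ) : 0 ≤ biasedArcsineDensity c 1 u := by
  unfold biasedArcsineDensity
  split_ifs with h
  · refine div_nonneg ?_ (by positivity)
    have : |c * u| ≤ 1 := by
      rw [abs_mul]; exact mul_le_one₀ hc (abs_nonneg _) h.le
    rw [div_one]
    linarith [le_abs_self (c * u)]
  · exact le_rfl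

lemma dens_total (c : ℝ) : ∫ u, biasedArcsineDensity c 1 u = 1 := by
  have h := dens_integral c (fun _ => 1)
  simp only [mul_one] at h
  rw [integral_complex_ofReal, intervalIntegral.integral_ofReal] at h
  have h2 : ∫ k in (0)..π, (1 - c * Real.cos k) = π := by
    rw [intervalIntegral.integral_sub (by simp) (Continuous.intervalIntegrable (by fun_prop) _ _)]
    simp
  rw [h2] at h
  have hpi : (π : ℂ) ≠ 0 := by exact_mod_cast Real.pi_ne_zero
  rw [one_div_mul_cancel hpi] at h
  exact_mod_cast h

/-- The limit law. -/
def limMeas (c : ℝ) : Measure ℝ :=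
  (volume : Measure ℝ).withDensity fun u => ENNReal.ofReal (biasedArcsineDensity c 1 u)

lemma limMeas_apply (c : ℝ) (hc : |c| ≤ 1) (s : Set ℝ) (hs : MeasurableSet s) :
    limMeas c s = ENNReal.ofReal (∫ u in s, biasedArcsineDensity c 1 u) := by
  rw [limMeas, withDensity_apply _ hs, ofReal_integral_eq_lintegral_ofReal
    (dens_integrable c).integrableOn (.of_forall fun u => dens_nonneg c hc u)]

lemma limMeas_prob (c : ℝ) (hc : |c| ≤ 1) : IsProbabilityMeasure (limMeas c) := by
  constructor
  rw [limMeas_apply c hc _ MeasurableSet.univ, setIntegral_univ, dens_total]; simp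

lemma limMeas_charFun (c : ℝ) (hc : |c| ≤ 1) (ξ : ℝ) :
    charFun (limMeas c) ξ = (1 / π : ℂ) * ∫ k in (0)..π, ((1 - c * Real.cos k : ℝ) : ℂ) *
      Complex.exp (ξ * (Real.cos k : ℝ) * Complex.I) := by
  rw [charFun_apply_real, limMeas, integral_withDensity_eq_integral_toReal_smul
    (dens_meas c).ennreal_ofReal (by simp), ← dens_integral c fun u => Complex.exp (ξ * u * Complex.I)]
  congr 1
  funext u
  rw [ENNReal.toReal_ofReal (dens_nonneg c hc u), Complex.real_smul]

/-- Law of the rescaled position. -/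
def walkMeas (ρ : ℝ) (φ : Fin 2 → ℂ) (n : ℕ) (d : ℝ) : Measure ℝ :=
  ∑ x ∈ Finset.Icc (-(n : ℤ)) n,
    ENNReal.ofReal (dtqwDist (ftdCoin ρ) φ n x) • Measure.dirac ((x : ℝ) / d)

lemma dist_nonneg' (H : Matrix (Fin 2) (Fin 2) ℂ) (φ : Fin 2 → ℂ) (n : ℕ) (x : ℤ) :
    0 ≤ dtqwDist H φ n x := by unfold dtqwDist; positivity

lemma walkMeas_apply (ρ : ℝ) (φ : Fin 2 → ℂ) (n : ℕ) (d : ℝ) (s : Set ℝ) [DecidablePred (· ∈ s)] :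
    walkMeas ρ φ n d s = ENNReal.ofReal (∑ x ∈ Finset.Icc (-(n : ℤ)) n,
      if (x : ℝ) / d ∈ s then dtqwDist (ftdCoin ρ) φ n x else 0) := by
  rw [walkMeas, ENNReal.ofReal_sum_of_nonneg]
  · simp only [Measure.finsetSum_apply, Measure.smul_apply, smul_eq_mul]
    refine Finset.sum_congr rfl fun x _ => ?_
    rw [Measure.dirac_apply]
    by_cases h : (x : ℝ) / d ∈ s <;> simp [h]
  · intro x _; split_ifs
    · exact dist_nonneg' _ _ _ _
    · exact le_rfl

lemma walkMeas_prob (ρ : ℝ) (h0 : 0 < ρ) (h1 : ρ < 1) (φ : Fin 2 → ℂ)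
    (hφ : ‖φ 0‖ ^ 2 + ‖φ 1‖ ^ 2 = 1) (n : ℕ) (d : ℝ) : IsProbabilityMeasure (walkMeas ρ φ n d) := by
  classical
  constructor
  rw [walkMeas_apply]
  simp [dist_sum ρ h0 h1 φ hφ n]

lemma walkMeas_charFun (ρ : ℝ) (φ : Fin 2 → ℂ) (n : ℕ) (d ξ : ℝ) :
    charFun (walkMeas ρ φ n d) ξ = ∑ x ∈ Finset.Icc (-(n : ℤ)) n,
      Complex.exp ((ξ / d : ℝ) * x * Complex.I) * (dtqwDist (ftdCoin ρ) φ n x : ℝ) := by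
  rw [charFun_apply_real, walkMeas, integral_finsetSum_measure]
  · refine Finset.sum_congr rfl fun x _ => ?_
    rw [integral_smul_measure, integral_dirac, ENNReal.toReal_ofReal (dist_nonneg' _ _ _ _),
      Complex.real_smul, mul_comm]
    congr 2
    push_cast; ring
  · intro x _
    exact (integrable_dirac (by simp)).smul_measure (by simp)

/-- **Theorem 4.** If `n√r(n) → ∞`, then `X^(F)_n/(n√r(n))` converges weakly to
`A^{φ_0}(1)` with density
`ρ(x;1) = {1 − (q_L q̄_R + q̄_L q_R)x}·1_{(−1,1)}(x)/(π√(1−x²))`. -/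
theorem ftd_dtqw_weak_limit
    (r : ℕ → ℝ) (hr0 : ∀ n, 0 < r n) (hr1 : ∀ n, r n < 1)
    (hrlim : Tendsto r atTop (𝓝 0))
    (hinf : Tendsto (fun n : ℕ => (n : ℝ) * Real.sqrt (r n)) atTop atTop)
    (qL qR : ℂ) (hq : ‖qL‖ ^ 2 + ‖qR‖ ^ 2 = 1)
    (φ₀ : Fin 2 → ℂ) (hφ₀ : φ₀ = fun i => if i = 0 then qL else qR) :
    ∀ y : ℝ, Tendsto
      (fun n : ℕ => ∑' x : ℤ,
        if (x : ℝ) / ((n : ℝ) * Real.sqrt (r n)) ≤ y then dtqwDist (ftdCoin (r n)) φ₀ n x else 0)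
      atTop (𝓝 (∫ u in Set.Iio y,
        biasedArcsineDensity ((qL * (starRingEnd ℂ) qR + (starRingEnd ℂ) qL * qR).re) 1 u)) := by
  intro y
  subst hφ₀
  set φ : Fin 2 → ℂ := fun i => if i = 0 then qL else qR with hφdef
  have hφ : ‖φ 0‖ ^ 2 + ‖φ 1‖ ^ 2 = 1 := by simpa [hφdef] using hq
  set c := (qL * (starRingEnd ℂ) qR + (starRingEnd ℂ) qL * qR).re with hcdef
  have hc : |c| ≤ 1 := by
    have h1 : ‖qL * (starRingEnd ℂ) qR + (starRingEnd ℂ) qL * qR‖ ≤ 2 * (‖qL‖ * ‖qR‖) := by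
      refine (norm_add_le _ _).trans ?_
      rw [norm_mul, norm_mul, RCLike.norm_conj, RCLike.norm_conj]; linarith
    have h2 := Complex.abs_re_le_norm (qL * (starRingEnd ℂ) qR + (starRingEnd ℂ) qL * qR)
    nlinarith [sq_nonneg (‖qL‖ - ‖qR‖)]
  let μ : ℕ → ProbabilityMeasure ℝ := fun n =>
    ⟨walkMeas (r n) φ n (n * √(r n)), walkMeas_prob (r n) (hr0 n) (hr1 n) φ hφ n _⟩
  let ν : ProbabilityMeasure ℝ := ⟨limMeas c, limMeas_prob c hc⟩
  have hconv : Tendsto μ atTop (𝓝 ν) := by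
    refine ProbabilityMeasure.tendsto_of_tendsto_charFun fun ξ => ?_
    have h := wk_char_tendsto r hr0 hr1 hrlim hinf φ hφ ξ
    simp only [μ, ν, ProbabilityMeasure.coe_mk, walkMeas_charFun, limMeas_charFun c hc]
    exact h
  have hfr : (ν : Measure ℝ) (frontier (Set.Iic y)) = 0 := by
    rw [frontier_Iic]
    exact (withDensity_absolutelyContinuous _ _) (by simp)
  have hset := ProbabilityMeasure.tendsto_measure_of_null_frontier_of_tendsto' hconv hfr
  have hreal := (ENNReal.tendsto_toReal (measure_ne_top (ν : Measure ℝ) (Set.Iic y))).comp hset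
  have hlim : ((ν : Measure ℝ) (Set.Iic y)).toReal =
      ∫ u in Set.Iio y, biasedArcsineDensity c 1 u := by
    show (limMeas c (Set.Iic y)).toReal = _
    rw [limMeas_apply c hc _ measurableSet_Iic, ENNReal.toReal_ofReal
      (integral_nonneg fun u => dens_nonneg c hc u), integral_Iic_eq_integral_Iio]
  rw [hlim] at hreal
  refine hreal.congr fun n => ?_
  classical
  show (walkMeas (r n) φ n (n * √(r n)) (Set.Iic y)).toReal = _
  rw [walkMeas_apply, ENNReal.toReal_ofReal (Finset.sum_nonneg fun x _ => by
    split_ifs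
    · exact dist_nonneg' _ _ _ _
    · exact le_rfl)]
  rw [tsum_eq_sum (s := Finset.Icc (-(n : ℤ)) n)]
  · simp only [Set.mem_Iic]
  · intro x hx
    simp [dtqwDist, dtqwAmp_support _ φ n x hx]
end
end

section
/- Let X^(Co)_n be the final-time-dependent correlated random walk on ℤ with parameter r(n) and any initial state p_0(x) = δ_0(x)(p_L e_L + p_R e_R) with p_L + p_R = 1. If n·r(n) → ∞ as n → ∞, then X^(Co)_n/√(n r(n)) converges weakly to the standard normal distribution N(0,1). -/
open MeasureTheory Filter Real Topology

noncomputable section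

/-- Vector-valued distribution `p_m(x)` of the final-time-dependent correlated random
walk on ℤ with stochastic coin `C = [[ρ, 1−ρ], [1−ρ, ρ]]`:
`p_m(x) = Q̃ p_{m−1}(x−1) + P̃ p_{m−1}(x+1)`, `p_0(x) = δ_0(x)(p_L e_L + p_R e_R)`. -/
def corVec (ρ pL pR : ℝ) : ℕ → ℤ → Fin 2 → ℝ
  | 0 => fun x i => if x = 0 then (if i = 0 then pL else pR) else 0
  | m + 1 => fun x i =>
      if i = 0 then
        ρ * corVec ρ pL pR m (x + 1) 0 + (1 - ρ) * corVec ρ pL pR m (x + 1) 1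
      else
        (1 - ρ) * corVec ρ pL pR m (x - 1) 0 + ρ * corVec ρ pL pR m (x - 1) 1

/-- Position distribution `P(X^(Co)_m = x) = ⟨e, p_m(x)⟩` of the correlated RW. -/
def corDist (ρ pL pR : ℝ) (m : ℕ) (x : ℤ) : ℝ :=
  corVec ρ pL pR m x 0 + corVec ρ pL pR m x 1

/-- Fourier transform of the vector-valued distribution. -/
def hatLR (ρ pL pR θ : ℝ) : ℕ → ℂ × ℂ
  | 0 => ((pL : ℂ), (pR : ℂ))
  | m + 1 =>
      (Complex.exp (-(θ * Complex.I)) *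
          (ρ * (hatLR ρ pL pR θ m).1 + (1 - ρ) * (hatLR ρ pL pR θ m).2),
        Complex.exp (θ * Complex.I) *
          ((1 - ρ) * (hatLR ρ pL pR θ m).1 + ρ * (hatLR ρ pL pR θ m).2))

def hatS (ρ pL pR θ : ℝ) (m : ℕ) : ℂ := (hatLR ρ pL pR θ m).1 + (hatLR ρ pL pR θ m).2

lemma hasSum_hatLR (ρ pL pR θ : ℝ) (m : ℕ) :
    HasSum (fun x : ℤ => (corVec ρ pL pR m x 0 : ℂ) * Complex.exp (θ * x * Complex.I))
      (hatLR ρ pL pR θ m).1 ∧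
    HasSum (fun x : ℤ => (corVec ρ pL pR m x 1 : ℂ) * Complex.exp (θ * x * Complex.I))
      (hatLR ρ pL pR θ m).2 := by
  induction m with
  | zero =>
    constructor
    · change HasSum _ (pL : ℂ)
      convert hasSum_ite_eq (0 : ℤ) (pL : ℂ) using 2 with x
      by_cases hx : x = 0 <;> simp [corVec, hx]
    · change HasSum _ (pR : ℂ)
      convert hasSum_ite_eq (0 : ℤ) (pR : ℂ) using 2 with x
      by_cases hx : x = 0 <;> simp [corVec, hx]
  | succ m ih =>
    obtain ⟨h0, h1⟩ := ih
    constructor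
    · have h := ((h0.mul_left (ρ : ℂ)).add (h1.mul_left (1 - ρ : ℂ))).mul_left
        (Complex.exp (-(θ * Complex.I)))
      rw [← (Equiv.addRight (1 : ℤ)).hasSum_iff] at h
      refine (congrArg (fun f => HasSum f _) (funext fun x => ?_)).mpr h
      simp only [corVec, Function.comp, Equiv.coe_addRight, if_true]
      have : Complex.exp (θ * ((x + 1 : ℤ) : ℂ) * Complex.I)
          = Complex.exp (θ * x * Complex.I) * Complex.exp (θ * Complex.I) := by
        rw [← Complex.exp_add]; congr 1; push_cast; ring
      rw [this, Complex.exp_neg]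
      have h2 := Complex.exp_ne_zero (θ * Complex.I)
      push_cast
      field_simp
    · have h := ((h0.mul_left (1 - ρ : ℂ)).add (h1.mul_left (ρ : ℂ))).mul_left
        (Complex.exp (θ * Complex.I))
      rw [← (Equiv.subRight (1 : ℤ)).hasSum_iff] at h
      refine (congrArg (fun f => HasSum f _) (funext fun x => ?_)).mpr h
      simp only [corVec, Function.comp, Equiv.subRight_apply]
      have : Complex.exp (θ * x * Complex.I)
          = Complex.exp (θ * ((x - 1 : ℤ) : ℂ) * Complex.I) * Complex.exp (θ * Complex.I) := by
        rw [← Complex.exp_add]; congr 1; push_cast; ring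
      rw [this]
      simp
      ring

lemma hasSum_hatS (ρ pL pR θ : ℝ) (m : ℕ) :
    HasSum (fun x : ℤ => (corDist ρ pL pR m x : ℂ) * Complex.exp (θ * x * Complex.I))
      (hatS ρ pL pR θ m) := by
  obtain ⟨h0, h1⟩ := hasSum_hatLR ρ pL pR θ m
  refine (congrArg (fun f => HasSum f _) (funext fun x => ?_)).mpr (h0.add h1)
  simp [corDist, add_mul]

lemma corVec_support (ρ pL pR : ℝ) (m : ℕ) : ∀ x : ℤ, x ∉ Finset.Icc (-(m : ℤ)) m →
    ∀ i, corVec ρ pL pR m x i = 0 := by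
  induction m with
  | zero =>
    intro x hx i
    have : x ≠ 0 := by rintro rfl; simp at hx
    simp [corVec, this]
  | succ m ih =>
    intro x hx i
    simp only [Finset.mem_Icc, not_and_or, not_le] at hx ih
    push_cast at hx
    have h1 := ih (x + 1) (by omega)
    have h2 := ih (x - 1) (by omega)
    simp [corVec, h1, h2]

lemma corVec_nonneg (ρ pL pR : ℝ) (h0 : 0 ≤ ρ) (h1 : ρ ≤ 1) (hpL : 0 ≤ pL) (hpR : 0 ≤ pR)
    (m : ℕ) : ∀ (x : ℤ) i, 0 ≤ corVec ρ pL pR m x i := by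
  induction m with
  | zero =>
    intro x i
    simp only [corVec]
    split_ifs <;> simp [*]
  | succ m ih =>
    intro x i
    have h2 : 0 ≤ 1 - ρ := by linarith
    simp only [corVec]
    split_ifs
    · exact add_nonneg (mul_nonneg h0 (ih _ _)) (mul_nonneg h2 (ih _ _))
    · exact add_nonneg (mul_nonneg h2 (ih _ _)) (mul_nonneg h0 (ih _ _))

lemma corDist_support (ρ pL pR : ℝ) (m : ℕ) (x : ℤ) (hx : x ∉ Finset.Icc (-(m : ℤ)) m) :
    corDist ρ pL pR m x = 0 := by
  simp [corDist, corVec_support ρ pL pR m x hx]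

lemma corDist_nonneg (ρ pL pR : ℝ) (h0 : 0 ≤ ρ) (h1 : ρ ≤ 1) (hpL : 0 ≤ pL) (hpR : 0 ≤ pR)
    (m : ℕ) (x : ℤ) : 0 ≤ corDist ρ pL pR m x :=
  add_nonneg (corVec_nonneg ρ pL pR h0 h1 hpL hpR m x 0)
    (corVec_nonneg ρ pL pR h0 h1 hpL hpR m x 1)

lemma sum_eq_hatS (ρ pL pR θ : ℝ) (m : ℕ) :
    ∑ x ∈ Finset.Icc (-(m : ℤ)) m,
      (corDist ρ pL pR m x : ℂ) * Complex.exp (θ * x * Complex.I) = hatS ρ pL pR θ m := by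
  refine HasSum.unique (hasSum_sum_of_ne_finset_zero ?_) (hasSum_hatS ρ pL pR θ m)
  intro x hx
  simp [corDist_support ρ pL pR m x hx]

lemma hatS_zero_theta (ρ pL pR : ℝ) (hp : pL + pR = 1) (m : ℕ) : hatS ρ pL pR 0 m = 1 := by
  induction m with
  | zero => simp only [hatS, hatLR]; exact_mod_cast hp
  | succ m ih =>
    simp only [hatS] at ih
    simp only [hatS, hatLR]
    simp
    linear_combination ih

lemma sum_corDist (ρ pL pR : ℝ) (hp : pL + pR = 1) (m : ℕ) :
    ∑ x ∈ Finset.Icc (-(m : ℤ)) m, corDist ρ pL pR m x = 1 := by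
  have h := sum_eq_hatS ρ pL pR 0 m
  rw [hatS_zero_theta ρ pL pR hp] at h
  simp at h
  exact_mod_cast h

lemma hatS_rec (ρ pL pR θ : ℝ) (m : ℕ) : hatS ρ pL pR θ (m + 2) =
    (2 * ρ * Real.cos θ : ℝ) * hatS ρ pL pR θ (m + 1) + (1 - 2 * ρ : ℝ) * hatS ρ pL pR θ m := by
  simp only [hatS, hatLR]
  push_cast
  have h1 : Complex.exp (-(θ * Complex.I)) * Complex.exp (θ * Complex.I) = 1 := by
    rw [← Complex.exp_add]; simp
  have h2 : (2 : ℂ) * Complex.cos θ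
      = Complex.exp (-(θ * Complex.I)) + Complex.exp (θ * Complex.I) := by
    rw [Complex.two_cos]; ring_nf
  generalize Complex.exp (-(θ * Complex.I)) = u at *
  generalize Complex.exp (θ * Complex.I) = v at *
  generalize (hatLR ρ pL pR θ m).1 = a
  generalize (hatLR ρ pL pR θ m).2 = b
  have h3 : (2 : ℂ) * ρ * Complex.cos θ = ρ * (u + v) := by rw [← h2]; ring
  rw [h3]
  linear_combination ((1 - 2 * ρ) * (a + b)) * h1

lemma closed_form (S : ℕ → ℂ) (l μ : ℂ)
    (h : ∀ m, S (m + 2) = (l + μ) * S (m + 1) - l * μ * S m) (m : ℕ) :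
    (l - μ) * S m = (S 1 - μ * S 0) * l ^ m - (S 1 - l * S 0) * μ ^ m := by
  induction m using Nat.twoStepInduction with
  | zero => ring
  | one => ring
  | more m h1 h2 =>
    rw [h]
    linear_combination (l + μ) * h2 - l * μ * h1

/-- Discriminant. -/
def discr (ρ θ : ℝ) : ℝ := (1 - ρ) ^ 2 - ρ ^ 2 * Real.sin θ ^ 2

def lamP (ρ θ : ℝ) : ℝ := ρ * Real.cos θ + √(discr ρ θ)

def lamM (ρ θ : ℝ) : ℝ := ρ * Real.cos θ - √(discr ρ θ)

lemma discr_nonneg (ρ θ : ℝ) (_h0 : 0 ≤ ρ) (h1 : ρ ≤ 1 / 2) : 0 ≤ discr ρ θ := by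
  have := Real.sin_sq_le_one θ
  unfold discr
  nlinarith [sq_nonneg ρ]

lemma hatS_closed (ρ pL pR θ : ℝ) (h0 : 0 ≤ ρ) (h1 : ρ ≤ 1 / 2) (hp : pL + pR = 1) (m : ℕ) :
    ((lamP ρ θ : ℂ) - lamM ρ θ) * hatS ρ pL pR θ m =
      (hatS ρ pL pR θ 1 - lamM ρ θ) * (lamP ρ θ : ℂ) ^ m
        - (hatS ρ pL pR θ 1 - lamP ρ θ) * (lamM ρ θ : ℂ) ^ m := by
  have hS0 : hatS ρ pL pR θ 0 = 1 := by simp only [hatS, hatLR]; exact_mod_cast hp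
  have hs : lamP ρ θ + lamM ρ θ = 2 * ρ * Real.cos θ := by unfold lamP lamM; ring
  have hm : lamP ρ θ * lamM ρ θ = -(1 - 2 * ρ) := by
    have := Real.sq_sqrt (discr_nonneg ρ θ h0 h1)
    have h2 := Real.sin_sq_add_cos_sq θ
    unfold lamP lamM
    have h3 : (ρ * Real.cos θ + √(discr ρ θ)) * (ρ * Real.cos θ - √(discr ρ θ))
      = ρ ^ 2 * Real.cos θ ^ 2 - √(discr ρ θ) ^ 2 := by ring
    rw [h3, this]
    unfold discr
    linear_combination ρ ^ 2 * h2
  have h := closed_form (hatS ρ pL pR θ) (lamP ρ θ) (lamM ρ θ) (by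
    intro m
    rw [hatS_rec, ← hs]
    have hm' : (lamP ρ θ : ℂ) * lamM ρ θ = -(1 - 2 * ρ : ℝ) := by exact_mod_cast hm
    rw [hm']
    push_cast
    ring) m
  rw [hS0] at h
  simpa using h

lemma abs_lamM_le (ρ θ : ℝ) (h0 : 0 ≤ ρ) (h1 : ρ ≤ 1 / 2) : |lamM ρ θ| ≤ 1 := by
  have h2 : √(discr ρ θ) ≤ 1 - ρ := by
    apply Real.sqrt_le_iff.2
    refine ⟨by linarith, ?_⟩
    unfold discr
    nlinarith [mul_nonneg (sq_nonneg ρ) (sq_nonneg (Real.sin θ))]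
  have h3 := Real.sqrt_nonneg (discr ρ θ)
  have h4 := Real.cos_le_one θ
  have h5 := Real.neg_one_le_cos θ
  unfold lamM
  rw [abs_le]
  constructor <;> nlinarith

section asymp

variable (r : ℕ → ℝ)

/-- The scaled frequency. -/
def scl (t : ℝ) (n : ℕ) : ℝ := t / √(n * r n)

lemma scl_tendsto (hinf : Tendsto (fun n : ℕ => (n : ℝ) * r n) atTop atTop) (t : ℝ) :
    Tendsto (scl r t) atTop (𝓝 0) :=
  Tendsto.div_atTop tendsto_const_nhds (Real.tendsto_sqrt_atTop.comp hinf)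

lemma scl_sq (t : ℝ) (n : ℕ) (h : 0 < n * r n) : n * r n * scl r t n ^ 2 = t ^ 2 := by
  unfold scl
  rw [div_pow, Real.sq_sqrt h.le]
  have h' := h.ne'
  rw [mul_div_cancel₀ _ h']

lemma first_term (hinf : Tendsto (fun n : ℕ => (n : ℝ) * r n) atTop atTop) (t : ℝ) :
    Tendsto (fun n : ℕ => n * (r n * (Real.cos (scl r t n) - 1))) atTop (𝓝 (-t ^ 2 / 2)) := by
  have hθ := scl_tendsto r hinf t
  rw [tendsto_iff_norm_sub_tendsto_zero]
  have hb : Tendsto (fun n : ℕ => t ^ 2 * scl r t n ^ 2) atTop (𝓝 0) := by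
    simpa using (hθ.pow 2).const_mul (t ^ 2)
  refine squeeze_zero' (Eventually.of_forall fun n => norm_nonneg _) ?_ hb
  have h1 : ∀ᶠ n in atTop, |scl r t n| ≤ 1 := by
    have := hθ.abs
    simp only [abs_zero] at this
    exact this.eventually (ge_mem_nhds one_pos)
  filter_upwards [h1, hinf.eventually_gt_atTop 0] with n h1 h2
  have h3 := Real.cos_bound h1
  have h4 := scl_sq r t n h2
  have h5 : (n : ℝ) * (r n * (Real.cos (scl r t n) - 1)) - -t ^ 2 / 2
      = n * r n * (Real.cos (scl r t n) - (1 - scl r t n ^ 2 / 2)) := by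
    rw [← h4]; ring
  rw [h5, Real.norm_eq_abs, abs_mul, abs_of_pos h2]
  calc _ ≤ n * r n * (|scl r t n| ^ 4 * (5 / 96)) := by gcongr
    _ = t ^ 2 * scl r t n ^ 2 * (5 / 96) := by
      rw [← h4, show |scl r t n| ^ 4 = scl r t n ^ 4 by
        rw [← abs_pow, abs_of_nonneg (by positivity)]]
      ring
    _ ≤ _ := by nlinarith [mul_nonneg (sq_nonneg t) (sq_nonneg (scl r t n))]



end asymp

lemma second_term (r : ℕ → ℝ) (hr : ∀ n, r n ∈ Set.Ioo (0 : ℝ) 1)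
    (hrlim : Tendsto r atTop (𝓝 0))
    (hinf : Tendsto (fun n : ℕ => (n : ℝ) * r n) atTop atTop) (t : ℝ) :
    Tendsto (fun n : ℕ => n * (√(discr (r n) (scl r t n)) - (1 - r n))) atTop (𝓝 0) := by
  rw [tendsto_zero_iff_norm_tendsto_zero]
  have hb : Tendsto (fun n : ℕ => 2 * t ^ 2 * r n) atTop (𝓝 0) := by
    simpa using hrlim.const_mul (2 * t ^ 2)
  refine squeeze_zero' (Eventually.of_forall fun n => norm_nonneg _) ?_ hb
  filter_upwards [hrlim.eventually (ge_mem_nhds (show (0 : ℝ) < 1 / 2 by norm_num)),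
    hinf.eventually_gt_atTop 0] with n h1 h2
  have h0 := (hr n).1
  have h4 := scl_sq r t n h2
  have hs := Real.sq_sqrt (discr_nonneg (r n) (scl r t n) h0.le h1)
  have hs0 := Real.sqrt_nonneg (discr (r n) (scl r t n))
  have hsin : Real.sin (scl r t n) ^ 2 ≤ scl r t n ^ 2 := by
    rw [sq_le_sq]; exact Real.abs_sin_le_abs
  set q := √(discr (r n) (scl r t n))
  have hq : (1 - r n - q) * (1 - r n + q) = r n ^ 2 * Real.sin (scl r t n) ^ 2 := by
    have : (1 - r n - q) * (1 - r n + q) = (1 - r n) ^ 2 - q ^ 2 := by ring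
    rw [this, hs]; unfold discr; ring
  have hpos : 1 / 2 ≤ 1 - r n + q := by linarith
  have hnn : 0 ≤ r n ^ 2 * Real.sin (scl r t n) ^ 2 := by positivity
  have hd0 : 0 ≤ 1 - r n - q := by
    by_contra hc
    push Not at hc
    nlinarith
  have hd : 1 - r n - q ≤ 2 * (r n ^ 2 * Real.sin (scl r t n) ^ 2) := by nlinarith
  have hn : (0 : ℝ) ≤ n := Nat.cast_nonneg n
  rw [Real.norm_eq_abs, abs_mul, abs_of_nonneg hn, abs_sub_comm, abs_of_nonneg hd0]
  calc _ ≤ (n : ℝ) * (2 * (r n ^ 2 * scl r t n ^ 2)) := by gcongr; exact hd.trans (by gcongr)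
    _ = 2 * (n * r n * scl r t n ^ 2) * r n := by ring
    _ = _ := by rw [h4]

lemma hatS_tendsto (r : ℕ → ℝ) (hr : ∀ n, r n ∈ Set.Ioo (0 : ℝ) 1)
    (hrlim : Tendsto r atTop (𝓝 0))
    (hinf : Tendsto (fun n : ℕ => (n : ℝ) * r n) atTop atTop)
    (pL pR : ℝ) (hp : pL + pR = 1) (t : ℝ) :
    Tendsto (fun n : ℕ => hatS (r n) pL pR (scl r t n) n) atTop
      (𝓝 ((Real.exp (-t ^ 2 / 2) : ℝ) : ℂ)) := by
  have hθ := scl_tendsto r hinf t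
  have hcos : Tendsto (fun n => Real.cos (scl r t n)) atTop (𝓝 1) := by
    simpa [Function.comp_def] using (Real.continuous_cos.tendsto 0).comp hθ
  have hsin : Tendsto (fun n => Real.sin (scl r t n)) atTop (𝓝 0) := by
    simpa [Function.comp_def] using (Real.continuous_sin.tendsto 0).comp hθ
  have hD : Tendsto (fun n => discr (r n) (scl r t n)) atTop (𝓝 1) := by
    simpa [discr] using ((hrlim.const_sub 1).pow 2).sub ((hrlim.pow 2).mul (hsin.pow 2))
  have hq : Tendsto (fun n => √(discr (r n) (scl r t n))) atTop (𝓝 1) := by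
    simpa using hD.sqrt
  have hP : Tendsto (fun n => lamP (r n) (scl r t n)) atTop (𝓝 1) := by
    simpa [lamP] using (hrlim.mul hcos).add hq
  have hM : Tendsto (fun n => lamM (r n) (scl r t n)) atTop (𝓝 (-1)) := by
    simpa [lamM] using (hrlim.mul hcos).sub hq
  have hPc : Tendsto (fun n => (lamP (r n) (scl r t n) : ℂ)) atTop (𝓝 1) := by
    simpa [Function.comp_def] using (Complex.continuous_ofReal.tendsto _).comp hP
  have hMc : Tendsto (fun n => (lamM (r n) (scl r t n) : ℂ)) atTop (𝓝 (-1)) := by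
    simpa [Function.comp_def] using (Complex.continuous_ofReal.tendsto _).comp hM
  have hrc : Tendsto (fun n => (r n : ℂ)) atTop (𝓝 0) := by
    simpa [Function.comp_def] using (Complex.continuous_ofReal.tendsto _).comp hrlim
  have hθc : Tendsto (fun n => (scl r t n : ℂ)) atTop (𝓝 0) := by
    simpa [Function.comp_def] using (Complex.continuous_ofReal.tendsto _).comp hθ
  have hS1 : Tendsto (fun n => hatS (r n) pL pR (scl r t n) 1) atTop (𝓝 1) := by
    have hc : Continuous (fun p : ℂ × ℂ => Complex.exp (-(p.2 * Complex.I)) *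
          (p.1 * (pL : ℂ) + (1 - p.1) * pR) +
        Complex.exp (p.2 * Complex.I) * ((1 - p.1) * pL + p.1 * pR)) := by fun_prop
    have h := (hc.tendsto (0, 0)).comp (hrc.prodMk_nhds hθc)
    have hp' : (pL : ℂ) + pR = 1 := by exact_mod_cast hp
    have e : ((pR : ℂ) + pL) = 1 := by rw [add_comm]; exact hp'
    simpa [hatS, hatLR, Function.comp_def, e] using h
  have hpow : Tendsto (fun n : ℕ => (lamP (r n) (scl r t n)) ^ n) atTop
      (𝓝 (Real.exp (-t ^ 2 / 2))) := by
    have h := Real.tendsto_one_add_pow_exp_of_tendsto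
      (g := fun n => lamP (r n) (scl r t n) - 1) (t := -t ^ 2 / 2) (by
        have h := (first_term r hinf t).add (second_term r hr hrlim hinf t)
        rw [add_zero] at h
        refine h.congr fun n => ?_
        unfold lamP; ring)
    simpa using h
  have hpowc : Tendsto (fun n : ℕ => (lamP (r n) (scl r t n) : ℂ) ^ n) atTop
      (𝓝 ((Real.exp (-t ^ 2 / 2) : ℝ) : ℂ)) := by
    refine ((Complex.continuous_ofReal.tendsto _).comp hpow).congr fun n => ?_
    simp
  have hhalf := hrlim.eventually (ge_mem_nhds (show (0 : ℝ) < 1 / 2 by norm_num))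
  have hB : Tendsto (fun n : ℕ => (hatS (r n) pL pR (scl r t n) 1 - lamP (r n) (scl r t n)) *
      (lamM (r n) (scl r t n) : ℂ) ^ n) atTop (𝓝 0) := by
    rw [tendsto_zero_iff_norm_tendsto_zero]
    have h0 : Tendsto (fun n : ℕ => ‖hatS (r n) pL pR (scl r t n) 1 - lamP (r n) (scl r t n)‖)
        atTop (𝓝 0) := by simpa using (hS1.sub hPc).norm
    refine squeeze_zero' (Eventually.of_forall fun n => norm_nonneg _) ?_ h0
    filter_upwards [hhalf] with n h1
    rw [norm_mul, norm_pow, Complex.norm_real, Real.norm_eq_abs]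
    exact mul_le_of_le_one_right (norm_nonneg _)
      (pow_le_one₀ (abs_nonneg _) (abs_lamM_le _ _ (hr n).1.le h1))
  have hnum := ((hS1.sub hMc).mul hpowc).sub hB
  have hden := hPc.sub hMc
  have hne : (1 : ℂ) - -1 ≠ 0 := by norm_num
  have hfin := hnum.div hden hne
  have he : ((1 - -1) * ((Real.exp (-t ^ 2 / 2) : ℝ) : ℂ) - 0) / (1 - -1)
      = ((Real.exp (-t ^ 2 / 2) : ℝ) : ℂ) := by rw [sub_zero, mul_div_cancel_left₀ _ hne]
  rw [he] at hfin
  refine hfin.congr' ?_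
  filter_upwards [hhalf, hden.eventually_ne hne] with n h1 h2
  simp only [Pi.div_apply]
  rw [← hatS_closed _ pL pR _ (hr n).1.le h1 hp n, mul_div_cancel_left₀ _ h2]

/-- Law of the scaled walk. -/
def lawM (ρ pL pR s : ℝ) (m : ℕ) : Measure ℝ :=
  ∑ x ∈ Finset.Icc (-(m : ℤ)) m,
    ENNReal.ofReal (corDist ρ pL pR m x) • Measure.dirac ((x : ℝ) / s)

lemma lawM_apply (ρ pL pR s : ℝ) (m : ℕ) (h0 : 0 ≤ ρ) (h1 : ρ ≤ 1) (hpL : 0 ≤ pL)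
    (hpR : 0 ≤ pR) (A : Set ℝ) [DecidablePred (· ∈ A)] (hA : MeasurableSet A) :
    lawM ρ pL pR s m A = ENNReal.ofReal (∑ x ∈ Finset.Icc (-(m : ℤ)) m,
      if (x : ℝ) / s ∈ A then corDist ρ pL pR m x else 0) := by
  rw [ENNReal.ofReal_sum_of_nonneg]
  · simp only [lawM, Measure.coe_finsetSum, Finset.sum_apply, Measure.smul_apply,
      Measure.dirac_apply' _ hA]
    refine Finset.sum_congr rfl fun x _ => ?_
    by_cases hx : (x : ℝ) / s ∈ A <;> simp [hx]
  · intro x _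
    split_ifs
    · exact corDist_nonneg ρ pL pR h0 h1 hpL hpR m x
    · exact le_rfl

lemma lawM_prob (ρ pL pR s : ℝ) (m : ℕ) (h0 : 0 ≤ ρ) (h1 : ρ ≤ 1) (hpL : 0 ≤ pL)
    (hpR : 0 ≤ pR) (hp : pL + pR = 1) : IsProbabilityMeasure (lawM ρ pL pR s m) := by
  classical
  constructor
  rw [lawM_apply ρ pL pR s m h0 h1 hpL hpR _ MeasurableSet.univ]
  simp [sum_corDist ρ pL pR hp]

lemma lawM_charFun (ρ pL pR s : ℝ) (m : ℕ) (h0 : 0 ≤ ρ) (h1 : ρ ≤ 1) (hpL : 0 ≤ pL)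
    (hpR : 0 ≤ pR) (t : ℝ) : charFun (lawM ρ pL pR s m) t = hatS ρ pL pR (t / s) m := by
  rw [charFun_apply_real, lawM, integral_finsetSum_measure]
  · rw [← sum_eq_hatS]
    refine Finset.sum_congr rfl fun x _ => ?_
    rw [integral_smul_measure, integral_dirac,
      ENNReal.toReal_ofReal (corDist_nonneg ρ pL pR h0 h1 hpL hpR m x), Complex.real_smul]
    congr 2
    push_cast
    ring
  · intro x _
    refine Integrable.smul_measure ?_ ENNReal.ofReal_ne_top
    exact integrable_dirac (by simp)

/-- **Appendix A (CLT).** For the final-time-dependent correlated RW with any initial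
state, if `n·r(n) → ∞` then `X^(Co)_n/√(n r(n))` converges weakly to `N(0,1)`. -/
theorem correlated_rw_clt
    (r : ℕ → ℝ) (hr : ∀ n, r n ∈ Set.Ioo (0 : ℝ) 1)
    (hrlim : Tendsto r atTop (𝓝 0))
    (hinf : Tendsto (fun n : ℕ => (n : ℝ) * r n) atTop atTop)
    (pL pR : ℝ) (hpL : 0 ≤ pL) (hpR : 0 ≤ pR) (hp : pL + pR = 1) :
    ∀ y : ℝ, Tendsto
      (fun n : ℕ => ∑' x : ℤ,
        if (x : ℝ) / Real.sqrt ((n : ℝ) * r n) ≤ y then corDist (r n) pL pR n x else 0)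
      atTop (𝓝 (∫ u in Set.Iio y, normalPDF 1 u)) := by
  intro y
  have hs : ∀ n, IsProbabilityMeasure (lawM (r n) pL pR (√(n * r n)) n) := fun n =>
    lawM_prob _ _ _ _ _ (hr n).1.le (hr n).2.le hpL hpR hp
  let μ : ℕ → ProbabilityMeasure ℝ := fun n => ⟨lawM (r n) pL pR (√(n * r n)) n, hs n⟩
  let μ₀ : ProbabilityMeasure ℝ := ⟨ProbabilityTheory.gaussianReal 0 1, inferInstance⟩
  have hw : Tendsto μ atTop (𝓝 μ₀) := by
    refine ProbabilityMeasure.tendsto_of_tendsto_charFun fun t => ?_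
    have h := hatS_tendsto r hr hrlim hinf pL pR hp t
    have e : charFun (μ₀ : Measure ℝ) t = ((Real.exp (-t ^ 2 / 2) : ℝ) : ℂ) := by
      change charFun (ProbabilityTheory.gaussianReal 0 1) t = _
      rw [ProbabilityTheory.charFun_gaussianReal]
      push_cast
      congr 1
      simp
      ring
    rw [e]
    refine h.congr fun n => ?_
    exact (lawM_charFun _ _ _ _ _ (hr n).1.le (hr n).2.le hpL hpR t).symm
  have hport := ProbabilityMeasure.tendsto_measure_of_null_frontier_of_tendsto' hw
    (E := Set.Iic y) (by
      rw [frontier_Iic]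
      have := ProbabilityTheory.nullSingletonClass_gaussianReal (μ := 0) (v := 1) one_ne_zero
      exact measure_singleton (μ := ProbabilityTheory.gaussianReal 0 1) y)
  have e2 : (μ₀ : Measure ℝ) (Set.Iic y) = ENNReal.ofReal (∫ u in Set.Iio y, normalPDF 1 u) := by
    change ProbabilityTheory.gaussianReal 0 1 (Set.Iic y) = _
    rw [ProbabilityTheory.gaussianReal_apply_eq_integral _ one_ne_zero,
      integral_Iic_eq_integral_Iio]
    simp [ProbabilityTheory.gaussianPDFReal, normalPDF]
  have hnn : 0 ≤ ∫ u in Set.Iio y, normalPDF 1 u := by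
    refine integral_nonneg fun u => ?_
    unfold normalPDF
    positivity
  rw [e2] at hport
  have h3 := (ENNReal.tendsto_toReal ENNReal.ofReal_ne_top).comp hport
  rw [ENNReal.toReal_ofReal hnn] at h3
  refine h3.congr fun n => ?_
  simp only [Function.comp]
  change (lawM (r n) pL pR (√(n * r n)) n (Set.Iic y)).toReal = _
  classical
  rw [lawM_apply _ _ _ _ _ (hr n).1.le (hr n).2.le hpL hpR _ measurableSet_Iic,
    ENNReal.toReal_ofReal, tsum_eq_sum (s := Finset.Icc (-(n : ℤ)) n)]
  · refine Finset.sum_congr rfl fun x _ => ?_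
    simp only [Set.mem_Iic]
  · intro x hx
    simp [corDist_support _ _ _ _ _ hx]
  · refine Finset.sum_nonneg fun x _ => ?_
    split_ifs
    · exact corDist_nonneg _ _ _ (hr n).1.le (hr n).2.le hpL hpR n x
    · exact le_rfl
end
end
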